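/- Let K be a finite simple graph each of whose connected components is a tree, a cycle graph, or a complete graph. If x, y ∈ R(K, SO(3)) satisfy o_K(x) = o_K(y), then x and y lie in the same connected component of R(K, SO(3)); that is, the map π₀(R(K, SO(3))) → {±1}^E induced by the obstruction map o_K is injective. In particular, R(K, SO(3)) has at most 2^{|E|} connected components. -/

import Mathlib

noncomputable section

/-- `SO(3)`: the space of real `3 × 3` matrices `A` with `A * Aᵀ = 1` and `det A = 1`,
topologized as a subspace of the space of matrices. -/
abbrev SO3 : Type := {A : Matrix (Fin 3) (Fin 3) ℝ // A * A.transpose = 1 ∧ A.det = 1}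

/-- The representation variety `R(K, SO(3))`: the subspace of `SO(3)^V` of tuples whose
entries commute along the edges of `K`. -/
def RepVar {V : Type*} (K : SimpleGraph V) : Set (V → SO3) :=
  {x | ∀ v w : V, K.Adj v w → (x v).1 * (x w).1 = (x w).1 * (x v).1}

/-- The identification `ℝ³ ≅ Im(ℍ)` sending `v` to the purely imaginary quaternion
`v 0 · i + v 1 · j + v 2 · k`. -/
def imQuat (v : Fin 3 → ℝ) : Quaternion ℝ := ⟨0, v 0, v 1, v 2⟩

/-- `QuatLift q x` says that the quaternion `q` is a lift of the rotation matrix `x` under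
the conjugation covering homomorphism `π : S³ → SO(3)`, i.e. conjugation by `q` on the
purely imaginary quaternions agrees with the action of `x` on `ℝ³ ≅ Im(ℍ)`. -/
def QuatLift (q : Quaternion ℝ) (x : Matrix (Fin 3) (Fin 3) ℝ) : Prop :=
  ∀ v : Fin 3 → ℝ, q * imQuat v * q⁻¹ = imQuat (x.mulVec v)

/-- `IsObstruction K x Λ` says that the edge marking `Λ` (with values in `{±1} ≅ ℤˣ`) is the
value `o_K(x)` of the obstruction map at `x`: for each edge `{v, w}` of `K` there are unit
quaternion lifts of `x v` and `x w` whose commutator is `Λ {v, w}`.  (The commutator of lifts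
is independent of the choice of lifts, so this determines `Λ` on the edges of `K`.) -/
def IsObstruction {V : Type*} (K : SimpleGraph V) (x : V → SO3) (Λ : Sym2 V → ℤˣ) : Prop :=
  ∀ v w : V, K.Adj v w → ∃ q p : Quaternion ℝ, ‖q‖ = 1 ∧ ‖p‖ = 1 ∧
    QuatLift q (x v).1 ∧ QuatLift p (x w).1 ∧
    q * p * q⁻¹ * p⁻¹ = ((Λ s(v, w) : ℤ) : Quaternion ℝ)

/-- The commutation relation `p * q = ε • (q * p)` with sign `ε`. -/
def SignCommute (ε : ℤˣ) (p q : Quaternion ℝ) : Prop :=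
  p * q = ((ε : ℤ) : ℝ) • (q * p)

/-- Nonzero quaternions that agree up to a real scalar. -/
def SameLine (p q : Quaternion ℝ) : Prop :=
  ∃ s : ℝ, s ≠ 0 ∧ q = s • p

/-- Nonzero purely imaginary quaternions. -/
def IsImaginary (p : Quaternion ℝ) : Prop :=
  p.re = 0 ∧ p ≠ 0

theorem signCommute_one {p q : Quaternion ℝ} : SignCommute 1 p q ↔ p * q = q * p := by
  simp [SignCommute]

theorem signCommute_neg_one {p q : Quaternion ℝ} :
    SignCommute (-1) p q ↔ p * q = -(q * p) := by
  simp [SignCommute]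

namespace SignCommute

variable {ε : ℤˣ} {p q r : Quaternion ℝ}

theorem symm (h : SignCommute ε p q) : SignCommute ε q p := by
  rcases Int.units_eq_one_or ε with rfl | rfl
  · rw [signCommute_one] at *; exact h.symm
  · rw [signCommute_neg_one] at *; rw [h, neg_neg]

theorem smul_right (h : SignCommute ε p q) (s : ℝ) : SignCommute ε p (s • q) := by
  unfold SignCommute at *
  rw [mul_smul_comm, h, smul_mul_assoc, smul_comm]

theorem smul_left (h : SignCommute ε p q) (s : ℝ) : SignCommute ε (s • p) q :=
  (h.symm.smul_right s).symm

theorem add_right (h : SignCommute ε p q) (h' : SignCommute ε p r) :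
    SignCommute ε p (q + r) := by
  unfold SignCommute at *
  rw [mul_add, h, h', add_mul, smul_add]

theorem add_left (h : SignCommute ε q p) (h' : SignCommute ε r p) :
    SignCommute ε (q + r) p :=
  (h.symm.add_right h'.symm).symm

theorem conj (h : SignCommute ε p q) {c : Quaternion ℝ} (hc : c ≠ 0) :
    SignCommute ε (c * p * c⁻¹) (c * q * c⁻¹) := by
  unfold SignCommute at *
  calc c * p * c⁻¹ * (c * q * c⁻¹) = c * (p * q) * c⁻¹ := by
        simp only [mul_assoc, inv_mul_cancel_left₀ hc]
    _ = _ := by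
        rw [h]
        simp only [mul_smul_comm, smul_mul_assoc, mul_assoc, inv_mul_cancel_left₀ hc]

theorem sameLine_right (h : SignCommute ε p q) (hl : SameLine q r) : SignCommute ε p r := by
  obtain ⟨s, -, rfl⟩ := hl
  exact h.smul_right s

theorem sameLine_left (h : SignCommute ε p q) (hl : SameLine p r) : SignCommute ε r q :=
  (h.symm.sameLine_right hl).symm

end SignCommute

namespace SameLine

variable {p q r : Quaternion ℝ}

theorem refl (p : Quaternion ℝ) : SameLine p p := ⟨1, one_ne_zero, by simp⟩

theorem symm (h : SameLine p q) : SameLine q p := by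
  obtain ⟨s, hs, rfl⟩ := h
  exact ⟨s⁻¹, inv_ne_zero hs, by simp [smul_smul, inv_mul_cancel₀ hs]⟩

theorem trans (h : SameLine p q) (h' : SameLine q r) : SameLine p r := by
  obtain ⟨s, hs, rfl⟩ := h
  obtain ⟨t, ht, rfl⟩ := h'
  exact ⟨t * s, mul_ne_zero ht hs, by rw [smul_smul]⟩

theorem ne_zero (h : SameLine p q) (hp : p ≠ 0) : q ≠ 0 := by
  obtain ⟨s, hs, rfl⟩ := h
  exact smul_ne_zero hs hp

theorem isImaginary (h : SameLine p q) (hp : IsImaginary p) : IsImaginary q := by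
  refine ⟨?_, h.ne_zero hp.2⟩
  obtain ⟨s, -, rfl⟩ := h
  simp [hp.1]

theorem commute (h : SameLine p q) : p * q = q * p := by
  obtain ⟨s, -, rfl⟩ := h
  simp

theorem conj (h : SameLine p q) (c : Quaternion ℝ) :
    SameLine (c * p * c⁻¹) (c * q * c⁻¹) := by
  obtain ⟨s, hs, rfl⟩ := h
  exact ⟨s, hs, by simp⟩

end SameLine

/-- Either `c` lies on the line of `p` or the segment line through `p` and `c` avoids `0`. -/
theorem sameLine_one_or_lineMap_ne_zero {p c : Quaternion ℝ} (hp : p ≠ 0) (hc : c ≠ 0) :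
    SameLine p c ∨ ∀ t : ℝ, (1 - t) • p + t • c ≠ 0 := by
  by_contra! h
  obtain ⟨h, t, ht⟩ := h
  have ht0 : t ≠ 0 := by
    rintro rfl
    simp [hp] at ht
  have ht1 : 1 - t ≠ 0 := by
    intro h1
    have : t = 1 := by linarith
    subst this
    simp [hc] at ht
  refine h ⟨-(1 - t) / t, div_ne_zero (neg_ne_zero.2 ht1) ht0, ?_⟩
  have : t • c = (-(1 - t)) • p := by
    rw [neg_smul]; exact eq_neg_of_add_eq_zero_right ht
  rw [div_eq_inv_mul, mul_smul, ← this, smul_smul, inv_mul_cancel₀ ht0, one_smul]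

namespace IsImaginary

variable {p q r : Quaternion ℝ}

theorem mul_self (hp : p.re = 0) :
    p * p = ((-Quaternion.normSq p : ℝ) : Quaternion ℝ) := by
  rw [← sq, Quaternion.sq_eq_neg_normSq.2 hp, Quaternion.coe_neg]

theorem normSq_pos (hp : IsImaginary p) : 0 < Quaternion.normSq p :=
  lt_of_le_of_ne Quaternion.normSq_nonneg (Ne.symm (Quaternion.normSq_ne_zero.2 hp.2))

theorem sameLine_of_commute (hp : IsImaginary p) (hq : IsImaginary q) (h : p * q = q * p) :
    SameLine p q := by
  have hN := hp.normSq_pos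
  have hI := congrArg QuaternionAlgebra.imI h
  have hJ := congrArg QuaternionAlgebra.imJ h
  have hK := congrArg QuaternionAlgebra.imK h
  simp [hp.1, hq.1] at hI hJ hK
  have key : q = ((p.imI * q.imI + p.imJ * q.imJ + p.imK * q.imK) / Quaternion.normSq p) • p := by
    rw [div_eq_inv_mul, mul_smul, eq_inv_smul_iff₀ hN.ne']
    apply Quaternion.ext <;> simp [Quaternion.normSq_def', hp.1, hq.1]
    · linear_combination (-p.imJ / 2) * hK + (p.imK / 2) * hJ
    · linear_combination (p.imI / 2) * hK - (p.imK / 2) * hI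
    · linear_combination (-p.imI / 2) * hJ + (p.imJ / 2) * hI
  refine ⟨_, ?_, key⟩
  intro h0
  rw [h0, zero_smul] at key
  exact hq.2 key

theorem not_anticommute (hp : IsImaginary p) (hq : IsImaginary q) (h : p * q = q * p) :
    p * q ≠ -(q * p) := by
  intro h'
  have : p * q = 0 := by
    rw [← h] at h'
    have h2 : (2 : ℝ) • (p * q) = 0 := by
      rw [two_smul]
      nth_rewrite 1 [h']
      exact neg_add_cancel _
    exact (smul_eq_zero.1 h2).resolve_left two_ne_zero
  rcases mul_eq_zero.1 this with h | h
  · exact hp.2 h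
  · exact hq.2 h

theorem of_anticommute (hp : p ≠ 0) (hq : q ≠ 0) (h : p * q = -(q * p)) : IsImaginary p := by
  refine ⟨?_, hp⟩
  have h1 : q * p * star q = (-Quaternion.normSq q) • p := by
    have : q * p = -(p * q) := by rw [h, neg_neg]
    rw [this, neg_mul, mul_assoc, Quaternion.self_mul_star, Quaternion.mul_coe_eq_smul, neg_smul]
  have h2 := congrArg QuaternionAlgebra.re h1
  have hN : 0 < Quaternion.normSq q :=
    lt_of_le_of_ne Quaternion.normSq_nonneg (Ne.symm (Quaternion.normSq_ne_zero.2 hq))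
  have h3 : (q * p * star q).re = Quaternion.normSq q * p.re := by
    simp [Quaternion.normSq_def']; ring
  rw [h3] at h2
  simp at h2
  nlinarith

theorem conj (hp : IsImaginary p) {c : Quaternion ℝ} (hc : c ≠ 0) :
    IsImaginary (c * p * c⁻¹) := by
  refine ⟨?_, mul_ne_zero (mul_ne_zero hc hp.2) (inv_ne_zero hc)⟩
  rw [Quaternion.inv_def, mul_smul_comm, Quaternion.re_smul]
  have : (c * p * star c).re = 0 := by
    simp [hp.1]; ring
  rw [this, smul_zero]

theorem commutator (hp : IsImaginary p) (hq : IsImaginary q) (h : p * q ≠ q * p) :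
    IsImaginary (p * q - q * p) ∧ SignCommute (-1) (p * q - q * p) p ∧
      SignCommute (-1) (p * q - q * p) q := by
  refine ⟨⟨?_, sub_ne_zero.2 h⟩, ?_, ?_⟩
  · simp; ring
  · rw [signCommute_neg_one]
    apply Quaternion.ext <;> simp [hp.1, hq.1] <;> ring
  · rw [signCommute_neg_one]
    apply Quaternion.ext <;> simp [hp.1, hq.1] <;> ring

theorem exists_anticommute (hp : IsImaginary p) : ∃ n, IsImaginary n ∧ SignCommute (-1) n p := by
  set i : Quaternion ℝ := ⟨0, 1, 0, 0⟩ with hi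
  set j : Quaternion ℝ := ⟨0, 0, 1, 0⟩ with hj
  have hij : i * p ≠ p * i ∨ j * p ≠ p * j := by
    by_contra! h
    obtain ⟨h, h'⟩ := h
    have hJ : p.imJ = 0 := by
      have := congrArg QuaternionAlgebra.imK h
      rw [Quaternion.imK_mul, Quaternion.imK_mul] at this
      simp only [hi] at this
      linarith
    have hK : p.imK = 0 := by
      have := congrArg QuaternionAlgebra.imJ h
      rw [Quaternion.imJ_mul, Quaternion.imJ_mul] at this
      simp only [hi] at this
      linarith
    have hI : p.imI = 0 := by
      have := congrArg QuaternionAlgebra.imK h'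
      rw [Quaternion.imK_mul, Quaternion.imK_mul] at this
      simp only [hj] at this
      linarith
    exact hp.2 (Quaternion.ext _ _ hp.1 hI hJ hK)
  rcases hij with h | h
  · have := commutator (p := i) ⟨rfl, fun h0 => h (by simp [h0])⟩ hp h
    exact ⟨_, this.1, this.2.2⟩
  · have := commutator (p := j) ⟨rfl, fun h0 => h (by simp [h0])⟩ hp h
    exact ⟨_, this.1, this.2.2⟩

theorem exists_anticommute_pair (hp : IsImaginary p) (hq : IsImaginary q) :
    ∃ n, IsImaginary n ∧ SignCommute (-1) n p ∧ SignCommute (-1) n q := by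
  by_cases h : p * q = q * p
  · obtain ⟨n, hn, hnp⟩ := hp.exists_anticommute
    exact ⟨n, hn, hnp, hnp.sameLine_right (hp.sameLine_of_commute hq h)⟩
  · exact ⟨_, hp.commutator hq h⟩

/-- Two imaginary quaternions orthogonal to two common non-parallel ones are parallel. -/
theorem sameLine_of_anticommute_pair {x y : Quaternion ℝ} (hp : IsImaginary p)
    (hq : IsImaginary q) (h : p * q ≠ q * p) (hx : IsImaginary x) (hy : IsImaginary y)
    (hxp : SignCommute (-1) x p) (hxq : SignCommute (-1) x q)
    (hyp : SignCommute (-1) y p) (hyq : SignCommute (-1) y q) : SameLine x y := by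
  have key : ∀ z, IsImaginary z → SignCommute (-1) z p → SignCommute (-1) z q →
      SameLine (p * q - q * p) z := by
    intro z hz hzp hzq
    refine sameLine_of_commute (hp.commutator hq h).1 hz ?_
    rw [signCommute_neg_one] at hzp hzq
    have h1 : p * q * z = z * (p * q) := by
      have : q * z = -(z * q) := by rw [hzq, neg_neg]
      rw [mul_assoc, this, mul_neg, ← mul_assoc, ← mul_assoc, hzp, neg_mul]
    have h2 : q * p * z = z * (q * p) := by
      have : p * z = -(z * p) := by rw [hzp, neg_neg]
      rw [mul_assoc, this, mul_neg, ← mul_assoc, ← mul_assoc, hzq, neg_mul]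
    rw [sub_mul, mul_sub, h1, h2]
  exact (key x hx hxp hxq).symm.trans (key y hy hyp hyq)

/-- Conjugation acts transitively on lines of imaginary quaternions, by elements commuting with
everything orthogonal to both lines. -/
theorem exists_conj (hp : IsImaginary p) (hq : IsImaginary q) :
    ∃ c, c ≠ 0 ∧ SameLine q (c * p * c⁻¹) ∧
      ∀ x, SignCommute (-1) x p → SignCommute (-1) x q → c * x = x * c := by
  by_cases hl : SameLine q p
  · exact ⟨1, one_ne_zero, by simpa using hl, by simp⟩
  have hP := hp.normSq_pos
  have hQ := hq.normSq_pos
  set s : ℝ := √(Quaternion.normSq p / Quaternion.normSq q) with hs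
  have hs0 : s ≠ 0 := (Real.sqrt_pos.2 (div_pos hP hQ)).ne'
  have hss : s * s * Quaternion.normSq q = Quaternion.normSq p := by
    rw [hs, Real.mul_self_sqrt (div_pos hP hQ).le, div_mul_cancel₀ _ hQ.ne']
  set b : Quaternion ℝ := s • q with hb
  set P : ℝ := Quaternion.normSq p with hPdef
  have hpp : p * p = ((-P : ℝ) : Quaternion ℝ) := mul_self hp.1
  have hbb : b * b = ((-P : ℝ) : Quaternion ℝ) := by
    rw [hb, smul_mul_smul_comm, mul_self hq.1, ← hss, ← Quaternion.coe_mul_eq_smul,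
      ← Quaternion.coe_mul, mul_neg]
  set c : Quaternion ℝ := (P : Quaternion ℝ) - b * p with hc
  have hcp : c * p = b * c := by
    rw [hc, sub_mul, mul_sub, mul_assoc, hpp, ← mul_assoc b b p, hbb]
    simp [Quaternion.coe_mul_eq_smul, Quaternion.mul_coe_eq_smul]
    abel
  have hc0 : c ≠ 0 := by
    intro h0
    apply hl
    have h1 : (P : Quaternion ℝ) = b * p := sub_eq_zero.1 h0
    have h2 : (P : Quaternion ℝ) * p = b * ((-P : ℝ) : Quaternion ℝ) := by
      rw [h1, mul_assoc, hpp]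
    rw [Quaternion.coe_mul_eq_smul, Quaternion.mul_coe_eq_smul, neg_smul, ← smul_neg] at h2
    have h3 : p = -b := smul_right_injective _ hP.ne' h2
    exact ⟨-s, neg_ne_zero.2 hs0, by rw [h3, hb, neg_smul]⟩
  refine ⟨c, hc0, ⟨s, hs0, ?_⟩, ?_⟩
  · rw [hcp, mul_assoc, mul_inv_cancel₀ hc0, mul_one]
  · intro x hxp hxq
    have hxb : x * b = -(b * x) := signCommute_neg_one.1 (hxq.smul_right s)
    rw [signCommute_neg_one] at hxp
    have : x * (b * p) = b * p * x := by
      have h1 : p * x = -(x * p) := by rw [hxp, neg_neg]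
      rw [← mul_assoc, hxb, neg_mul, mul_assoc, mul_assoc, h1, mul_neg]
    rw [hc, sub_mul, mul_sub, this, Quaternion.coe_mul_eq_smul, Quaternion.mul_coe_eq_smul]

end IsImaginary

/-- A quaternion commuting with two anticommuting imaginary quaternions is real. -/
theorem eq_coe_re_of_commute {c p q : Quaternion ℝ} (hp : IsImaginary p) (hq : IsImaginary q)
    (hpq : SignCommute (-1) p q) (hcp : c * p = p * c) (hcq : c * q = q * c) :
    c = (c.re : Quaternion ℝ) := by
  by_contra h
  have hI : IsImaginary (c - (c.re : Quaternion ℝ)) := ⟨by simp, sub_ne_zero.2 h⟩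
  have h1 := hI.sameLine_of_commute hp (by rw [sub_mul, mul_sub, hcp, Quaternion.coe_commutes])
  have h2 := hI.sameLine_of_commute hq (by rw [sub_mul, mul_sub, hcq, Quaternion.coe_commutes])
  exact hp.not_anticommute hq (h1.symm.trans h2).commute (signCommute_neg_one.1 hpq)

/-- A nonzero quaternion is determined up to a scalar by the signs with which it commutes with
two anticommuting imaginary quaternions. -/
theorem sameLine_of_signCommute_pair {p q x y : Quaternion ℝ} {ε ε' : ℤˣ} (hp : IsImaginary p)
    (hq : IsImaginary q) (hpq : SignCommute (-1) p q) (hx : x ≠ 0) (hy : y ≠ 0)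
    (hxp : SignCommute ε x p) (hxq : SignCommute ε' x q)
    (hyp : SignCommute ε y p) (hyq : SignCommute ε' y q) : SameLine x y := by
  have key : ∀ {ε : ℤˣ} {p}, SignCommute ε x p → SignCommute ε y p →
      y * x⁻¹ * p = p * (y * x⁻¹) := by
    intro ε p hx' hy'
    have h1 : x⁻¹ * p = ((ε : ℤ) : ℝ) • (p * x⁻¹) := by
      have h := hx'.symm
      unfold SignCommute at h
      calc x⁻¹ * p = x⁻¹ * (p * x) * x⁻¹ := by
            rw [mul_assoc, mul_assoc, mul_inv_cancel₀ hx, mul_one]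
        _ = _ := by rw [h, mul_smul_comm, smul_mul_assoc, inv_mul_cancel_left₀ hx]
    have h2 := hy'.symm
    unfold SignCommute at h2
    rw [mul_assoc, h1, mul_smul_comm, ← mul_assoc, ← mul_assoc, h2, smul_mul_assoc]
  have := eq_coe_re_of_commute hp hq hpq (key hxp hyp) (key hxq hyq)
  refine ⟨(y * x⁻¹).re, ?_, ?_⟩
  · intro h0
    rw [h0, Quaternion.coe_zero] at this
    exact mul_ne_zero hy (inv_ne_zero hx) this
  · calc y = y * x⁻¹ * x := by rw [inv_mul_cancel_right₀ hx]
      _ = _ := by rw [← Quaternion.coe_mul_eq_smul, ← this]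

/-- An elementary deformation inside `X`: a path in `X`, or a rescaling of the entries. -/
def DeformStep {ι : Type*} (X : Set (ι → Quaternion ℝ)) (a b : ι → Quaternion ℝ) : Prop :=
  (∃ f : ℝ → ι → Quaternion ℝ, Continuous f ∧ (∀ t, f t ∈ X) ∧ f 0 = a ∧ f 1 = b) ∨
    (a ∈ X ∧ b ∈ X ∧ ∀ i, SameLine (a i) (b i))

/-- The equivalence relation generated by paths in `X` and rescalings of the entries. -/
def Deform {ι : Type*} (X : Set (ι → Quaternion ℝ)) : (ι → Quaternion ℝ) →
    (ι → Quaternion ℝ) → Prop :=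
  Relation.EqvGen (DeformStep X)

namespace Deform

variable {ι κ : Type*} {X : Set (ι → Quaternion ℝ)} {Y : Set (κ → Quaternion ℝ)}
  {a b c : ι → Quaternion ℝ}

theorem refl (a : ι → Quaternion ℝ) : Deform X a a := Relation.EqvGen.refl a

theorem symm (h : Deform X a b) : Deform X b a := Relation.EqvGen.symm _ _ h

theorem trans (h : Deform X a b) (h' : Deform X b c) : Deform X a c :=
  Relation.EqvGen.trans _ _ _ h h'

theorem of_path {f : ℝ → ι → Quaternion ℝ} (hf : Continuous f) (hX : ∀ t, f t ∈ X) :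
    Deform X (f 0) (f 1) :=
  Relation.EqvGen.rel _ _ (Or.inl ⟨f, hf, hX, rfl, rfl⟩)

theorem of_sameLine (ha : a ∈ X) (hb : b ∈ X) (h : ∀ i, SameLine (a i) (b i)) :
    Deform X a b :=
  Relation.EqvGen.rel _ _ (Or.inr ⟨ha, hb, h⟩)

theorem map {σ : (ι → Quaternion ℝ) → (κ → Quaternion ℝ)} (hσ : Continuous σ)
    (hX : Set.MapsTo σ X Y)
    (hl : ∀ a b, (∀ i, SameLine (a i) (b i)) → ∀ k, SameLine (σ a k) (σ b k))
    (h : Deform X a b) : Deform Y (σ a) (σ b) := by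
  induction h with
  | rel a b h =>
    rcases h with ⟨f, hf, hfX, rfl, rfl⟩ | ⟨ha, hb, hab⟩
    · exact of_path (f := fun t => σ (f t)) (hσ.comp hf) fun t => hX (hfX t)
    · exact of_sameLine (hX ha) (hX hb) (hl a b hab)
  | refl a => exact refl _
  | symm a b _ ih => exact ih.symm
  | trans a b c _ _ ih ih' => exact ih.trans ih'

end Deform

/-- Tuples of nonzero quaternions that commute up to the sign `Λ` along the edges of `K`. -/
def SignedConfig {V : Type*} (K : SimpleGraph V) (Λ : Sym2 V → ℤˣ) : Set (V → Quaternion ℝ) :=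
  {a | (∀ v, a v ≠ 0) ∧ ∀ v w, K.Adj v w → SignCommute (Λ s(v, w)) (a v) (a w)}

/-- All tuples with the same signs along the edges can be deformed into each other. -/
def SignConnected {V : Type*} (K : SimpleGraph V) : Prop :=
  ∀ (Λ : Sym2 V → ℤˣ), ∀ a ∈ SignedConfig K Λ, ∀ b ∈ SignedConfig K Λ,
    Deform (SignedConfig K Λ) a b

namespace SignedConfig

variable {V : Type*} {K : SimpleGraph V} {Λ : Sym2 V → ℤˣ} {a b : V → Quaternion ℝ}

theorem conj_mem (ha : a ∈ SignedConfig K Λ) (B : Set V) [DecidablePred (· ∈ B)]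
    {c : Quaternion ℝ} (hc : c ≠ 0)
    (hB : ∀ v w, K.Adj v w → v ∉ B → w ∈ B → c * a v = a v * c) :
    (fun v => if v ∈ B then c * a v * c⁻¹ else a v) ∈ SignedConfig K Λ := by
  have key : ∀ v w, K.Adj v w → v ∉ B → w ∈ B → c * a v * c⁻¹ = a v := by
    intro v w h hv hw
    rw [hB v w h hv hw, mul_inv_cancel_right₀ hc]
  refine ⟨fun v => ?_, fun v w h => ?_⟩
  · dsimp only
    split_ifs
    · exact mul_ne_zero (mul_ne_zero hc (ha.1 v)) (inv_ne_zero hc)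
    · exact ha.1 v
  · by_cases hv : v ∈ B <;> by_cases hw : w ∈ B <;> simp only [hv, hw, if_true, if_false]
    · exact (ha.2 v w h).conj hc
    · rw [← key w v h.symm hw hv]
      exact (ha.2 v w h).conj hc
    · rw [← key v w h hv hw]
      exact (ha.2 v w h).conj hc
    · exact ha.2 v w h

theorem deform_conj (ha : a ∈ SignedConfig K Λ) (B : Set V) [DecidablePred (· ∈ B)]
    {c : Quaternion ℝ} (hc : c ≠ 0)
    (hB : ∀ v w, K.Adj v w → v ∉ B → w ∈ B → c * a v = a v * c) :
    Deform (SignedConfig K Λ) a (fun v => if v ∈ B then c * a v * c⁻¹ else a v) := by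
  rcases sameLine_one_or_lineMap_ne_zero one_ne_zero hc with ⟨s, hs, rfl⟩ | h
  · convert Deform.refl a with v
    have : (s • (1 : Quaternion ℝ)) * a v * (s • 1)⁻¹ = a v := by
      have h1 : (s • (1 : Quaternion ℝ)) * a v = a v * (s • 1) := by simp
      rw [h1, mul_inv_cancel_right₀ hc]
    rw [this, ite_self]
  · have := Deform.of_path (X := SignedConfig K Λ)
      (f := fun t v => if v ∈ B then ((1 - t) • 1 + t • c) * a v * ((1 - t) • 1 + t • c)⁻¹
        else a v) ?_ ?_
    · simpa using this
    · refine continuous_pi fun v => ?_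
      split_ifs
      · have hcont : Continuous fun t : ℝ => (1 - t) • (1 : Quaternion ℝ) + t • c := by fun_prop
        exact (hcont.mul continuous_const).mul (hcont.inv₀ h)
      · exact continuous_const
    · intro t
      refine conj_mem ha B (h t) fun v w hvw hv hw => ?_
      rw [add_mul, mul_add, smul_mul_assoc, smul_mul_assoc, hB v w hvw hv hw]
      simp

/-- Vertices none of whose edges carries the sign `-1` can be deformed to `1`. -/
theorem deform_one (ha : a ∈ SignedConfig K Λ) (Z : Set V) [DecidablePred (· ∈ Z)]
    (hZ : ∀ v w, K.Adj v w → v ∈ Z → Λ s(v, w) = 1) :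
    (fun v => if v ∈ Z then 1 else a v) ∈ SignedConfig K Λ ∧
      Deform (SignedConfig K Λ) a (fun v => if v ∈ Z then 1 else a v) := by
  classical
  have hcomm : ∀ s t : V → ℝ, ∀ v w, K.Adj v w → SignCommute (Λ s(v, w))
      (if v ∈ Z then s v • 1 + t v • a v else a v)
      (if w ∈ Z then s w • 1 + t w • a w else a w) := by
    intro s t v w h
    have h' := ha.2 v w h
    by_cases hv : v ∈ Z
    · rw [hZ v w h hv] at h' ⊢
      have h1 : ∀ x, SignCommute 1 1 x := fun x => signCommute_one.2 (by simp)
      by_cases hw : w ∈ Z <;> simp only [hv, hw, if_true, if_false]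
      · exact (((h1 _).smul_left _).add_right ((h1 _).smul_left _)).add_left
          ((((h1 _).smul_left _).symm).add_right ((h'.smul_right _).smul_left _))
      · exact ((h1 _).smul_left _).add_left (h'.smul_left _)
    · by_cases hw : w ∈ Z <;> simp only [hv, hw, if_true, if_false]
      · have h1 : ∀ x, SignCommute 1 x 1 := fun x => signCommute_one.2 (by simp)
        have := hZ w v h.symm hw
        rw [Sym2.eq_swap] at this
        rw [this] at h' ⊢
        exact ((h1 _).smul_right _).add_right (h'.smul_right _)
      · exact h'
  have hmem : ∀ s t : V → ℝ, (∀ v, s v • 1 + t v • a v ≠ 0) →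
      (fun v => if v ∈ Z then s v • 1 + t v • a v else a v) ∈ SignedConfig K Λ := by
    refine fun s t hne => ⟨fun v => ?_, hcomm s t⟩
    dsimp only
    split_ifs
    · exact hne v
    · exact ha.1 v
  have h1 := hmem 1 0 (by simp)
  simp only [Pi.one_apply, Pi.zero_apply, one_smul, zero_smul, add_zero] at h1
  refine ⟨h1, ?_⟩
  -- first rescale the real entries to `1`
  let u : V → ℝ := fun v => if SameLine 1 (a v) then 1 else 0
  have hu : ∀ r : ℝ, ∀ v, (u v + (1 - u v) * r) • 1 + ((1 - u v) * (1 - r)) • a v ≠ 0 := by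
    intro r v
    by_cases hv : SameLine 1 (a v)
    · simp [u, hv]
    · simpa [u, hv] using
        ((sameLine_one_or_lineMap_ne_zero one_ne_zero (ha.1 v)).resolve_left hv) (1 - r)
  have hu0 := hmem _ _ (hu 0)
  have hu1 := Deform.of_path (X := SignedConfig K Λ) (f := fun r v => if v ∈ Z then
    (u v + (1 - u v) * r) • 1 + ((1 - u v) * (1 - r)) • a v else a v) ?_ fun r => hmem _ _ (hu r)
  · refine (Deform.of_sameLine ha hu0 fun v => ?_).trans ?_
    · split_ifs with hv
      · by_cases hv' : SameLine 1 (a v)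
        · simpa [u, hv'] using hv'.symm
        · simpa [u, hv'] using SameLine.refl (a v)
      · exact SameLine.refl _
    · simpa using hu1
  · refine continuous_pi fun v => ?_
    split_ifs <;> fun_prop

end SignedConfig

/-- Sequences of imaginary quaternions of length `m + 1`, padded by `1`, with consecutive entries
orthogonal, starting on the line of `p` and ending on the line of `q`. -/
def OrthoChain (m : ℕ) (p q : Quaternion ℝ) : Set (ℕ → Quaternion ℝ) :=
  {w | (∀ i ≤ m, IsImaginary (w i)) ∧ (∀ i, m < i → w i = 1) ∧
    (∀ i < m, SignCommute (-1) (w i) (w (i + 1))) ∧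
    SignCommute 1 (w 0) p ∧ SignCommute 1 (w m) q}

namespace OrthoChain

open Function

variable {m k : ℕ} {p q x y : Quaternion ℝ} {w w' : ℕ → Quaternion ℝ}

theorem update_mem (hw : w ∈ OrthoChain m p q) (hk : k + 2 ≤ m) (hx : IsImaginary x)
    (h₁ : SignCommute (-1) (w k) x) (h₂ : SignCommute (-1) x (w (k + 2))) :
    update w (k + 1) x ∈ OrthoChain m p q := by
  obtain ⟨hI, hone, hadj, hp, hq⟩ := hw
  refine ⟨fun i hi => ?_, fun i hi => ?_, fun i hi => ?_, ?_, ?_⟩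
  · by_cases h : i = k + 1
    · subst h; simpa using hx
    · simpa [h] using hI i hi
  · rw [update_of_ne (by omega)]
    exact hone i hi
  · by_cases h : i = k + 1
    · subst h; simpa using h₂
    · by_cases h' : i = k
      · subst h'; simpa using h₁
      · simpa [h, h'] using hadj i hi
  · rw [update_of_ne (by omega)]
    exact hp
  · rw [update_of_ne (by omega)]
    exact hq

theorem update_two_mem (hw : w ∈ OrthoChain m p q) (hk : k + 3 ≤ m) (hx : IsImaginary x)
    (hy : IsImaginary y) (h₁ : SignCommute (-1) (w k) x) (h₂ : SignCommute (-1) x y)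
    (h₃ : SignCommute (-1) y (w (k + 3))) :
    update (update w (k + 1) x) (k + 2) y ∈ OrthoChain m p q := by
  obtain ⟨hI, hone, hadj, hp, hq⟩ := hw
  refine ⟨fun i hi => ?_, fun i hi => ?_, fun i hi => ?_, ?_, ?_⟩
  · by_cases h : i = k + 1
    · subst h; simpa using hx
    · by_cases h' : i = k + 2
      · subst h'; simpa using hy
      · simpa [h, h'] using hI i hi
  · rw [update_of_ne (by omega), update_of_ne (by omega)]
    exact hone i hi
  · by_cases h : i = k + 1
    · subst h; simpa using h₂
    · by_cases h' : i = k
      · subst h'; simpa using h₁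
      · by_cases h'' : i = k + 2
        · subst h''; simpa using h₃
        · simpa [h, h', h''] using hadj i hi
  · rw [update_of_ne (by omega), update_of_ne (by omega)]
    exact hp
  · rw [update_of_ne (by omega), update_of_ne (by omega)]
    exact hq

theorem lineMap_isImaginary (hx : IsImaginary x) (hy : IsImaginary y) (h : ¬ SameLine x y)
    (t : ℝ) : IsImaginary ((1 - t) • x + t • y) :=
  ⟨by simp [hx.1, hy.1],
    (sameLine_one_or_lineMap_ne_zero hx.2 hy.2).resolve_left h t⟩

theorem signCommute_lineMap {ε : ℤˣ} {z : Quaternion ℝ} (hx : SignCommute ε z x)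
    (hy : SignCommute ε z y) (t : ℝ) : SignCommute ε z ((1 - t) • x + t • y) :=
  (hx.smul_right _).add_right (hy.smul_right _)

theorem deform_update (hw : w ∈ OrthoChain m p q) (hk : k + 2 ≤ m) (hx : IsImaginary x)
    (h₁ : SignCommute (-1) (w k) x) (h₂ : SignCommute (-1) x (w (k + 2))) :
    Deform (OrthoChain m p q) w (update w (k + 1) x) := by
  have hI := hw.1 (k + 1) (by omega)
  by_cases hl : SameLine (w (k + 1)) x
  · refine Deform.of_sameLine hw (update_mem hw hk hx h₁ h₂) fun i => ?_
    by_cases h : i = k + 1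
    · subst h; simpa using hl
    · simpa [h] using SameLine.refl (w i)
  · have := Deform.of_path (X := OrthoChain m p q)
      (f := fun t => update w (k + 1) ((1 - t) • w (k + 1) + t • x)) ?_ fun t => ?_
    · simpa using this
    · exact continuous_const.update _ (by fun_prop)
    · exact update_mem hw hk (lineMap_isImaginary hI hx hl t)
        (signCommute_lineMap (hw.2.2.1 k (by omega)) h₁ t)
        (signCommute_lineMap (hw.2.2.1 (k + 1) (by omega)).symm h₂.symm t).symm

theorem deform_update_two (hw : w ∈ OrthoChain m p q) (hk : k + 3 ≤ m) (hx : IsImaginary x)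
    (hy : IsImaginary y) (h₁ : SignCommute (-1) (w k) x) (h₂ : SignCommute (-1) x y)
    (h₃ : SignCommute (-1) y (w (k + 3))) :
    Deform (OrthoChain m p q) w (update (update w (k + 1) x) (k + 2) y) := by
  have hk0 := hw.1 k (by omega)
  have hk1 := hw.1 (k + 1) (by omega)
  have hk2 := hw.1 (k + 2) (by omega)
  have hk3 := hw.1 (k + 3) (by omega)
  have h01 := hw.2.2.1 k (by omega)
  have h12 := hw.2.2.1 (k + 1) (by omega)
  have h23 := hw.2.2.1 (k + 2) (by omega)
  have hw' := update_two_mem hw hk hx hy h₁ h₂ h₃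
  by_cases h03 : SignCommute (-1) (w k) (w (k + 3))
  · have key : ∀ v ∈ OrthoChain m p q, v k = w k → v (k + 3) = w (k + 3) →
        Deform (OrthoChain m p q) v
          (update (update v (k + 2) (w k)) (k + 1) (w (k + 3))) := by
      intro v hv hvk hvk3
      have hv01 := hv.2.2.1 k (by omega)
      have hmem := update_mem (k := k + 1) (x := w k) hv hk hk0 (by rw [← hvk]; exact hv01.symm)
        (by rw [show k + 1 + 2 = k + 3 from rfl, hvk3]; exact h03)
      refine (deform_update (k := k + 1) (x := w k) hv hk hk0 (by rw [← hvk]; exact hv01.symm)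
        (by rw [show k + 1 + 2 = k + 3 from rfl, hvk3]; exact h03)).trans ?_
      refine deform_update hmem (by omega) hk3 ?_ ?_
      · rw [update_of_ne (by omega), hvk]
        exact h03
      · simpa using h03.symm
    have e1 := key _ hw rfl rfl
    have e2 := key _ hw' (by simp) (by simp)
    refine e1.trans ?_
    convert e2.symm using 1
    ext1 i
    by_cases hi : i = k + 1
    · subst hi; simp
    · by_cases hi' : i = k + 2
      · subst hi'; simp
      · simp [hi, hi']
  · have hne : ∀ u, IsImaginary u → SignCommute (-1) (w k) u →
        u * w (k + 3) ≠ w (k + 3) * u := by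
      intro u hu hku h
      exact h03 (hku.sameLine_right (hu.sameLine_of_commute hk3 h))
    have hline : ∀ u v, IsImaginary u → IsImaginary v → SignCommute (-1) (w k) u →
        SignCommute (-1) u v → SignCommute (-1) v (w (k + 3)) →
        SameLine v (u * w (k + 3) - w (k + 3) * u) := by
      intro u v hu hv hku huv hv3
      have h := hne u hu hku
      obtain ⟨hc, hc1, hc2⟩ := hu.commutator hk3 h
      exact hu.sameLine_of_anticommute_pair hk3 h hv hc huv.symm hv3 hc1 hc2
    by_cases hl : SameLine (w (k + 1)) x
    · refine Deform.of_sameLine hw hw' fun i => ?_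
      by_cases hi : i = k + 1
      · subst hi; simpa using hl
      · by_cases hi' : i = k + 2
        · subst hi'
          have e1 := hline _ _ hx hk2 h₁ (h12.sameLine_left hl) h23
          have e2 := hline _ _ hx hy h₁ h₂ h₃
          simpa using e1.trans e2.symm
        · simpa [hi, hi'] using SameLine.refl (w i)
    · let u : ℝ → Quaternion ℝ := fun t => (1 - t) • w (k + 1) + t • x
      have hu : ∀ t, IsImaginary (u t) := lineMap_isImaginary hk1 hx hl
      have hku : ∀ t, SignCommute (-1) (w k) (u t) := signCommute_lineMap h01 h₁
      have huc : Continuous u := by fun_prop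
      have hmem : ∀ t, update (update w (k + 1) (u t)) (k + 2)
          (u t * w (k + 3) - w (k + 3) * u t) ∈ OrthoChain m p q := by
        intro t
        obtain ⟨hc, hc1, hc2⟩ := (hu t).commutator hk3 (hne _ (hu t) (hku t))
        exact update_two_mem hw hk (hu t) hc (hku t) hc1.symm hc2
      have hpath := Deform.of_path (X := OrthoChain m p q) (f := fun t =>
        update (update w (k + 1) (u t)) (k + 2) (u t * w (k + 3) - w (k + 3) * u t))
        ((continuous_const.update _ huc).update _ (by fun_prop)) hmem
      have hu0 : u 0 = w (k + 1) := by simp [u]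
      have hu1 : u 1 = x := by simp [u]
      refine (Deform.of_sameLine hw (hmem 0) fun i => ?_).trans
        (hpath.trans (Deform.of_sameLine (hmem 1) hw' fun i => ?_))
      · by_cases hi : i = k + 2
        · subst hi
          simpa [hu0] using hline _ _ hk1 hk2 h01 h12 h23
        · by_cases hi' : i = k + 1
          · subst hi'; simpa [hu0] using SameLine.refl _
          · simpa [hi, hi'] using SameLine.refl _
      · by_cases hi : i = k + 2
        · subst hi
          simpa [hu1] using (hline _ _ hx hy h₁ h₂ h₃).symm
        · simpa [hi, hu1] using SameLine.refl _

/-- Repeat the first two entries of a sequence. -/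
def stutter (v : ℕ → Quaternion ℝ) (j : ℕ) : Quaternion ℝ :=
  v (if j ≤ 1 then j else j - 2)

theorem stutter_mem {v : ℕ → Quaternion ℝ} (hm : 2 ≤ m) (hv : v ∈ OrthoChain m p q) :
    stutter v ∈ OrthoChain (m + 2) p q := by
  obtain ⟨hI, hone, hadj, hp, hq⟩ := hv
  refine ⟨fun i hi => hI _ (by split_ifs <;> omega),
    fun i hi => hone _ (by split_ifs <;> omega), fun i hi => ?_, hp, ?_⟩
  · unfold stutter
    rcases i with _ | _ | i
    · exact hadj 0 (by omega)
    · exact (hadj 0 (by omega)).symm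
    · exact hadj i (by omega)
  · exact hq

theorem deform_stutter (hm : 2 ≤ m) (hw : w ∈ OrthoChain (m + 2) p q) :
    ∃ v ∈ OrthoChain m p q, Deform (OrthoChain (m + 2) p q) w (stutter v) := by
  obtain ⟨n, hn, hn0, hn4⟩ := (hw.1 0 (by omega)).exists_anticommute_pair (hw.1 4 (by omega))
  obtain ⟨z, hz, hzn, hz3⟩ := hn.exists_anticommute_pair (hw.1 3 (by omega))
  have hw₁ := update_two_mem (k := 0) hw (by omega) hn hz hn0.symm hzn.symm hz3
  have e₁ := deform_update_two (k := 0) hw (by omega) hn hz hn0.symm hzn.symm hz3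
  set w₁ := update (update w (0 + 1) n) (0 + 2) z with hw₁_def
  have h1 : w₁ 1 = n := by simp [w₁]
  have h4 : w₁ 4 = w 4 := by simp [w₁]
  have hw₂ := update_two_mem (k := 1) (x := w 0) (y := n) hw₁ (by omega) (hw.1 0 (by omega)) hn
    (by rw [h1]; exact hn0) hn0.symm (by rw [show 1 + 3 = 4 from rfl, h4]; exact hn4)
  have e₂ := deform_update_two (k := 1) (x := w 0) (y := n) hw₁ (by omega) (hw.1 0 (by omega)) hn
    (by rw [h1]; exact hn0) hn0.symm (by rw [show 1 + 3 = 4 from rfl, h4]; exact hn4)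
  set w₂ := update (update w₁ (1 + 1) (w 0)) (1 + 2) n with hw₂_def
  have g0 : w₂ 0 = w 0 := by simp [w₂, w₁]
  have g1 : w₂ 1 = n := by simp [w₂, w₁]
  have g2 : w₂ 2 = w 0 := by simp [w₂]
  have g3 : w₂ 3 = n := by simp [w₂]
  refine ⟨fun j => w₂ (if j ≤ 1 then j else j + 2), ?_, ?_⟩
  · obtain ⟨hI, hone, hadj, hp, hq⟩ := hw₂
    refine ⟨fun i hi => hI _ (by split_ifs <;> omega),
      fun i hi => hone _ (by split_ifs <;> omega), fun i hi => ?_, hp, ?_⟩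
    · rcases i with _ | _ | i
      · exact hadj 0 (by omega)
      · have := hadj 3 (by omega)
        rw [g3, ← g1] at this
        exact this
      · exact hadj (i + 4) (by omega)
    · simpa [show ¬ m ≤ 1 by omega] using hq
  · convert e₁.trans e₂ using 1
    ext1 j
    rcases j with _ | _ | _ | _ | j
    · rfl
    · rfl
    · exact g0.trans g2.symm
    · exact g1.trans g3.symm
    · simp [stutter]

/-- Any two orthogonal chains with the same end lines can be deformed into each other. -/
theorem deform (hp : IsImaginary p) (hq : IsImaginary q) (hw : w ∈ OrthoChain m p q)
    (hw' : w' ∈ OrthoChain m p q) : Deform (OrthoChain m p q) w w' := by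
  induction m using Nat.strong_induction_on generalizing w w' with
  | _ m ih =>
  have hfirst : SameLine (w 0) (w' 0) :=
    ((hw.1 0 (by omega)).sameLine_of_commute hp (signCommute_one.1 hw.2.2.2.1)).trans
      ((hw'.1 0 (by omega)).sameLine_of_commute hp (signCommute_one.1 hw'.2.2.2.1)).symm
  have hlast : SameLine (w m) (w' m) :=
    ((hw.1 m le_rfl).sameLine_of_commute hq (signCommute_one.1 hw.2.2.2.2)).trans
      ((hw'.1 m le_rfl).sameLine_of_commute hq (signCommute_one.1 hw'.2.2.2.2)).symm
  have hout : ∀ i, m < i → SameLine (w i) (w' i) := fun i hi => by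
    rw [hw.2.1 i hi, hw'.2.1 i hi]
    exact SameLine.refl _
  rcases m with _ | _ | _ | _ | m
  · refine Deform.of_sameLine hw hw' fun i => ?_
    rcases i with _ | i
    · exact hfirst
    · exact hout _ (by omega)
  · refine Deform.of_sameLine hw hw' fun i => ?_
    rcases i with _ | _ | i
    · exact hfirst
    · exact hlast
    · exact hout _ (by omega)
  · have hx := hw'.1 1 (by omega)
    have h₁ : SignCommute (-1) (w 0) (w' 1) :=
      (hw'.2.2.1 0 (by omega)).sameLine_left hfirst.symm
    have h₂ : SignCommute (-1) (w' 1) (w (0 + 2)) :=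
      (hw'.2.2.1 1 (by omega)).sameLine_right hlast.symm
    refine (deform_update (k := 0) hw (by omega) hx h₁ h₂).trans
      (Deform.of_sameLine (update_mem (k := 0) hw (by omega) hx h₁ h₂) hw' fun i => ?_)
    rcases i with _ | _ | _ | i
    · simpa using hfirst
    · simpa using SameLine.refl _
    · simpa using hlast
    · simpa using hout _ (by omega)
  · have hx := hw'.1 1 (by omega)
    have hy := hw'.1 2 (by omega)
    have h₁ : SignCommute (-1) (w 0) (w' 1) :=
      (hw'.2.2.1 0 (by omega)).sameLine_left hfirst.symm
    have h₂ := hw'.2.2.1 1 (by omega)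
    have h₃ : SignCommute (-1) (w' 2) (w (0 + 3)) :=
      (hw'.2.2.1 2 (by omega)).sameLine_right hlast.symm
    refine (deform_update_two (k := 0) hw (by omega) hx hy h₁ h₂ h₃).trans
      (Deform.of_sameLine (update_two_mem (k := 0) hw (by omega) hx hy h₁ h₂ h₃) hw'
        fun i => ?_)
    rcases i with _ | _ | _ | _ | i
    · simpa using hfirst
    · simpa using SameLine.refl _
    · simpa using SameLine.refl _
    · simpa using hlast
    · simpa using hout _ (by omega)
  · obtain ⟨v, hv, e⟩ := deform_stutter (m := m + 2) (by omega) hw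
    obtain ⟨v', hv', e'⟩ := deform_stutter (m := m + 2) (by omega) hw'
    refine e.trans (Deform.trans ?_ e'.symm)
    refine Deform.map (σ := stutter) ?_ (fun u hu => stutter_mem (by omega) hu) ?_
      (ih (m + 2) (by omega) hv hv')
    · exact continuous_pi fun j => continuous_apply _
    · exact fun a b h k => h _

end OrthoChain

/-- For commuting or anticommuting pairs whose first entries lie on the same line, the first pair
can be conjugated by an element fixing its first entry so that the second entries align. -/
theorem exists_conj_sameLine {ε : ℤˣ} {p q p' q' : Quaternion ℝ} (hp : p = 1 ∨ IsImaginary p)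
    (hq : (q = 1 ∧ q' = 1) ∨ (IsImaginary q ∧ IsImaginary q')) (h : SignCommute ε p q)
    (h' : SignCommute ε p' q') (hl : SameLine p p') :
    ∃ c, c ≠ 0 ∧ c * p = p * c ∧ SameLine (c * q * c⁻¹) q' := by
  rcases hq with ⟨rfl, rfl⟩ | ⟨hq, hq'⟩
  · exact ⟨1, one_ne_zero, by simp, by simpa using SameLine.refl _⟩
  obtain ⟨c, hc, hcl, hcc⟩ := hq.exists_conj hq'
  rcases hp with rfl | hp
  · exact ⟨c, hc, by simp, hcl.symm⟩
  have hp' := hl.isImaginary hp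
  rcases Int.units_eq_one_or ε with rfl | rfl
  · refine ⟨1, one_ne_zero, by simp, ?_⟩
    have h1 := hp.sameLine_of_commute hq (signCommute_one.1 h)
    have h2 := hp'.sameLine_of_commute hq' (signCommute_one.1 h')
    simpa using h1.symm.trans (hl.trans h2)
  · exact ⟨c, hc, hcc p h (h'.sameLine_left hl.symm), hcl.symm⟩

/-- The vertices all of whose edges carry the sign `1`. -/
def centralVertices {V : Type*} (K : SimpleGraph V) (Λ : Sym2 V → ℤˣ) : Set V :=
  {v | ∀ w, K.Adj v w → Λ s(v, w) = 1}

/-- Signed configurations equal to `1` at the central vertices and imaginary elsewhere. -/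
def NormalConfig {V : Type*} (K : SimpleGraph V) (Λ : Sym2 V → ℤˣ) : Set (V → Quaternion ℝ) :=
  {a | a ∈ SignedConfig K Λ ∧ (∀ v ∈ centralVertices K Λ, a v = 1) ∧
    ∀ v ∉ centralVertices K Λ, IsImaginary (a v)}

namespace NormalConfig

variable {V : Type*} {K : SimpleGraph V} {Λ : Sym2 V → ℤˣ} {a b : V → Quaternion ℝ}

theorem exists_deform (ha : a ∈ SignedConfig K Λ) :
    ∃ a' ∈ NormalConfig K Λ, Deform (SignedConfig K Λ) a a' := by
  classical
  obtain ⟨h, h'⟩ := SignedConfig.deform_one ha (centralVertices K Λ) fun v w hvw hv => hv w hvw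
  refine ⟨_, ⟨h, fun v hv => by simp [hv], fun v hv => ?_⟩, h'⟩
  simp only [hv, if_false]
  simp only [centralVertices, Set.mem_ofPred_eq, not_forall] at hv
  obtain ⟨w, hvw, hne⟩ := hv
  have h2 := ha.2 v w hvw
  rw [(Int.units_eq_one_or _).resolve_left hne, signCommute_neg_one] at h2
  exact IsImaginary.of_anticommute (ha.1 v) (ha.1 w) h2

theorem conj (ha : a ∈ NormalConfig K Λ) (B : Set V) [DecidablePred (· ∈ B)] {c : Quaternion ℝ}
    (hc : c ≠ 0) (hB : ∀ v w, K.Adj v w → v ∉ B → w ∈ B → c * a v = a v * c) :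
    (fun v => if v ∈ B then c * a v * c⁻¹ else a v) ∈ NormalConfig K Λ := by
  refine ⟨SignedConfig.conj_mem ha.1 B hc hB, fun v hv => ?_, fun v hv => ?_⟩
  · simp [ha.2.1 v hv, mul_inv_cancel₀ hc]
  · dsimp only
    split_ifs
    · exact (ha.2.2 v hv).conj hc
    · exact ha.2.2 v hv

theorem eq_one_or_isImaginary (ha : a ∈ NormalConfig K Λ) (v : V) :
    a v = 1 ∨ IsImaginary (a v) := by
  by_cases hv : v ∈ centralVertices K Λ
  · exact Or.inl (ha.2.1 v hv)
  · exact Or.inr (ha.2.2 v hv)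

theorem eq_one_or_isImaginary_pair (ha : a ∈ NormalConfig K Λ) (hb : b ∈ NormalConfig K Λ)
    (v : V) : (a v = 1 ∧ b v = 1) ∨ (IsImaginary (a v) ∧ IsImaginary (b v)) := by
  by_cases hv : v ∈ centralVertices K Λ
  · exact Or.inl ⟨ha.2.1 v hv, hb.2.1 v hv⟩
  · exact Or.inr ⟨ha.2.2 v hv, hb.2.2 v hv⟩

theorem exists_deform_sameLine (ha : a ∈ NormalConfig K Λ) (hb : b ∈ NormalConfig K Λ) (w : V) :
    ∃ a' ∈ NormalConfig K Λ, Deform (SignedConfig K Λ) a a' ∧ SameLine (a' w) (b w) := by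
  classical
  obtain ⟨c, hc, -, hl⟩ := exists_conj_sameLine (ε := 1) (p := 1) (p' := 1) (Or.inl rfl)
    (eq_one_or_isImaginary_pair ha hb w) (signCommute_one.2 (by simp))
    (signCommute_one.2 (by simp)) (SameLine.refl 1)
  have hB : ∀ v w, K.Adj v w → v ∉ (Set.univ : Set V) → w ∈ (Set.univ : Set V) →
      c * a v = a v * c := fun v _ _ hv => absurd (Set.mem_univ v) hv
  exact ⟨_, conj ha Set.univ hc hB, SignedConfig.deform_conj ha.1 Set.univ hc hB, by simpa using hl⟩

/-- Align the entry at `w` by conjugating a branch `B` that contains `w` and is attached to the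
rest of the graph only through `v` and through vertices with entry `1`. -/
theorem exists_deform_branch (ha : a ∈ NormalConfig K Λ) (hb : b ∈ NormalConfig K Λ) {v w : V}
    (hvw : K.Adj v w) (hl : SameLine (a v) (b v)) (B : Set V) (hw : w ∈ B)
    (hB : ∀ x y, K.Adj x y → x ∉ B → y ∈ B → x = v ∨ a x = 1) :
    ∃ a' ∈ NormalConfig K Λ, Deform (SignedConfig K Λ) a a' ∧ (∀ x ∉ B, a' x = a x) ∧
      SameLine (a' w) (b w) := by
  classical
  obtain ⟨c, hc, hcv, hcl⟩ := exists_conj_sameLine (eq_one_or_isImaginary ha v)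
    (eq_one_or_isImaginary_pair ha hb w) (ha.1.2 v w hvw) (hb.1.2 v w hvw) hl
  have hB' : ∀ x y, K.Adj x y → x ∉ B → y ∈ B → c * a x = a x * c := by
    intro x y hxy hx hy
    rcases hB x y hxy hx hy with rfl | h
    · exact hcv
    · simp [h]
  exact ⟨_, conj ha B hc hB', SignedConfig.deform_conj ha.1 B hc hB',
    fun x hx => by simp [hx], by simpa [hw] using hcl⟩

end NormalConfig

theorem signConnected_of_normalConfig {V : Type*} {K : SimpleGraph V}
    (h : ∀ (Λ : Sym2 V → ℤˣ), ∀ a ∈ NormalConfig K Λ, ∀ b ∈ NormalConfig K Λ,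
      Deform (SignedConfig K Λ) a b) : SignConnected K := by
  intro Λ a ha b hb
  obtain ⟨a', ha', e⟩ := NormalConfig.exists_deform ha
  obtain ⟨b', hb', e'⟩ := NormalConfig.exists_deform hb
  exact e.trans ((h Λ a' ha' b' hb').trans e'.symm)

theorem signConnected_top {V : Type*} : SignConnected (⊤ : SimpleGraph V) := by
  refine signConnected_of_normalConfig fun Λ a ha b hb => ?_
  by_cases hZ : ∀ v, v ∈ centralVertices ⊤ Λ
  · have : a = b := funext fun v => (ha.2.1 v (hZ v)).trans (hb.2.1 v (hZ v)).symm
    rw [this]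
    exact Deform.refl b
  push Not at hZ
  obtain ⟨v, hv⟩ := hZ
  have hv' := hv
  simp only [centralVertices, Set.mem_ofPred_eq, not_forall] at hv'
  obtain ⟨w, hvw, hne⟩ := hv'
  have hΛ : Λ s(v, w) = -1 := (Int.units_eq_one_or _).resolve_left hne
  obtain ⟨a₁, ha₁, e₁, hl₁⟩ := NormalConfig.exists_deform_sameLine ha hb v
  obtain ⟨a₂, ha₂, e₂, hout, hlw⟩ := NormalConfig.exists_deform_branch ha₁ hb hvw hl₁ {v}ᶜ
    (by simpa using hvw.ne') fun x y _ hx _ => Or.inl (by simpa using hx)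
  have hlv : SameLine (a₂ v) (b v) := by
    rw [hout v (by simp)]
    exact hl₁
  refine (e₁.trans e₂).trans (Deform.of_sameLine ha₂.1 hb.1 fun z => ?_)
  by_cases hzv : z = v
  · rw [hzv]; exact hlv
  by_cases hzw : z = w
  · rw [hzw]; exact hlw
  have hedge := ha₂.1.2 v w hvw
  rw [hΛ] at hedge
  have hvI := ha₂.2.2 v hv
  have hwI : IsImaginary (a₂ w) := by
    have := signCommute_neg_one.1 hedge.symm
    exact IsImaginary.of_anticommute (ha₂.1.1 w) (ha₂.1.1 v) this
  exact sameLine_of_signCommute_pair hvI hwI hedge (ha₂.1.1 z) (hb.1.1 z)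
    (ha₂.1.2 z v hzv) (ha₂.1.2 z w hzw) ((hb.1.2 z v hzv).sameLine_right hlv.symm)
    ((hb.1.2 z w hzw).sameLine_right hlw.symm)

theorem signConnected_of_isTree {V : Type*} [Finite V] {K : SimpleGraph V} (hK : K.IsTree) :
    SignConnected K := by
  classical
  have := Fintype.ofFinite V
  refine signConnected_of_normalConfig fun Λ a ha b hb => ?_
  obtain ⟨r⟩ := hK.connected.nonempty
  obtain ⟨a₁, ha₁, e₁, hl₁⟩ := NormalConfig.exists_deform_sameLine ha hb r
  refine e₁.trans ?_
  clear e₁ ha a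
  have key : ∀ n : ℕ, ∀ S : Finset V, Sᶜ.card = n → r ∈ S →
      (∀ z ∈ S, ∃ p : K.Walk r z, ∀ x ∈ p.support, x ∈ S) → ∀ a ∈ NormalConfig K Λ,
      (∀ z ∈ S, SameLine (a z) (b z)) → Deform (SignedConfig K Λ) a b := by
    intro n
    induction n with
    | zero =>
      intro S hS _ _ a ha hl
      refine Deform.of_sameLine ha.1 hb.1 fun z => hl z ?_
      by_contra hz
      have : z ∈ Sᶜ := Finset.mem_compl.2 hz
      rw [Finset.card_eq_zero.1 hS] at this
      exact absurd this (Finset.notMem_empty z)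
    | succ n ih =>
      intro S hS hr hp a ha hl
      obtain ⟨y, hy⟩ := Finset.card_pos.1 (by omega : 0 < Sᶜ.card)
      obtain ⟨py⟩ := hK.connected.preconnected r y
      obtain ⟨⟨⟨v, w⟩, hvw⟩, -, hv, hw⟩ :=
        py.exists_boundary_dart (S : Set V) hr (by simpa using hy)
      simp only [Finset.mem_coe] at hv hw
      have hvw' : K.Adj v w := hvw
      have hbr : ¬ (K.deleteEdges {s(v, w)}).Reachable v w :=
        SimpleGraph.isBridge_iff.1 (SimpleGraph.isAcyclic_iff_forall_adj_isBridge.1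
          hK.isAcyclic hvw')
      have hSv : ∀ z ∈ S, (K.deleteEdges {s(v, w)}).Reachable r z := by
        intro z hz
        obtain ⟨p, hpS⟩ := hp z hz
        refine SimpleGraph.reachable_deleteEdges_iff_exists_walk.2 ⟨p, fun h => ?_⟩
        exact hw (hpS w (p.snd_mem_support_of_mem_edges h))
      let B : Set V := {z | (K.deleteEdges {s(v, w)}).Reachable w z}
      have hBS : ∀ z ∈ S, z ∉ B := fun z hz hzB =>
        hbr (((hSv v hv).symm.trans (hSv z hz)).trans (SimpleGraph.Reachable.symm hzB))
      have hBv : ∀ x y, K.Adj x y → x ∉ B → y ∈ B → x = v := by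
        intro x y hxy hx hy
        by_cases he : s(x, y) = s(v, w)
        · rcases Sym2.eq_iff.1 he with ⟨h, -⟩ | ⟨h, -⟩
          · exact h
          · exact absurd (h ▸ SimpleGraph.Reachable.refl w : x ∈ B) hx
        · refine absurd (SimpleGraph.Reachable.trans hy (SimpleGraph.Adj.reachable ?_)) hx
          rw [SimpleGraph.deleteEdges_adj]
          refine ⟨hxy.symm, fun h => he ?_⟩
          rw [Sym2.eq_swap]
          exact h
      obtain ⟨a', ha', e, hout, hlw⟩ := NormalConfig.exists_deform_branch ha hb hvw' (hl v hv) B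
        (SimpleGraph.Reachable.refl w) (fun x y hxy hx hy => Or.inl (hBv x y hxy hx hy))
      refine e.trans (ih (insert w S) ?_ (Finset.mem_insert_of_mem hr) ?_ a' ha' ?_)
      · rw [Finset.card_compl, Finset.card_insert_of_notMem hw, ← Nat.sub_sub,
          ← Finset.card_compl, hS, Nat.add_sub_cancel]
      · intro z hz
        rcases Finset.mem_insert.1 hz with rfl | hz
        · obtain ⟨p, hpS⟩ := hp v hv
          refine ⟨p.concat hvw', fun x hx => ?_⟩
          rw [SimpleGraph.Walk.support_concat, List.mem_append, List.mem_singleton] at hx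
          rcases hx with hx | rfl
          · exact Finset.mem_insert_of_mem (hpS x hx)
          · exact Finset.mem_insert_self _ _
        · obtain ⟨p, hpS⟩ := hp z hz
          exact ⟨p, fun x hx => Finset.mem_insert_of_mem (hpS x hx)⟩
      · intro z hz
        rcases Finset.mem_insert.1 hz with rfl | hz
        · exact hlw
        · rw [hout z (hBS z hz)]
          exact hl z hz
  refine key _ {r} rfl (by simp) ?_ a₁ ha₁ (by simpa using hl₁)
  intro z hz
  rw [Finset.mem_singleton] at hz
  subst hz
  exact ⟨SimpleGraph.Walk.nil, by simp⟩

/-- Sign-connectedness of a graph follows from that of its connected components. -/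
theorem signConnected_of_components {V : Type*} [Finite V] {K : SimpleGraph V}
    (h : ∀ c : K.ConnectedComponent, SignConnected (K.induce c.supp)) : SignConnected K := by
  classical
  have := Fintype.ofFinite V
  have := Fintype.ofFinite K.ConnectedComponent
  intro Λ a ha b hb
  have key : ∀ s : Finset K.ConnectedComponent,
      (fun v => if K.connectedComponentMk v ∈ s then b v else a v) ∈ SignedConfig K Λ ∧
      Deform (SignedConfig K Λ) a
        (fun v => if K.connectedComponentMk v ∈ s then b v else a v) := by
    intro s
    induction s using Finset.induction_on with
    | empty => simpa using ⟨ha, Deform.refl a⟩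
    | insert c s hc ih =>
      obtain ⟨hmem, e⟩ := ih
      set d : V → Quaternion ℝ := fun v => if K.connectedComponentMk v ∈ s then b v else a v
        with hd
      let Λ' : Sym2 c.supp → ℤˣ := fun e => Λ (e.map (↑))
      let σ : (c.supp → Quaternion ℝ) → V → Quaternion ℝ := fun x v =>
        if hv : v ∈ c.supp then x ⟨v, hv⟩ else d v
      have hpos : ∀ x v (hv : v ∈ c.supp), σ x v = x ⟨v, hv⟩ := fun _ _ hv => dif_pos hv
      have hneg : ∀ x v, v ∉ c.supp → σ x v = d v := fun _ _ hv => dif_neg hv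
      have hres : ∀ x ∈ SignedConfig K Λ,
          (fun v : c.supp => x v) ∈ SignedConfig (K.induce c.supp) Λ' :=
        fun x hx => ⟨fun v => hx.1 v, fun v w hvw => hx.2 v w hvw⟩
      have hσ : Set.MapsTo σ (SignedConfig (K.induce c.supp) Λ') (SignedConfig K Λ) := by
        intro x hx
        refine ⟨fun v => ?_, fun v w hvw => ?_⟩
        · dsimp only [σ]
          split_ifs with hv
          · exact hx.1 ⟨v, hv⟩
          · exact hmem.1 v
        · have hiff : v ∈ c.supp ↔ w ∈ c.supp := c.mem_supp_congr_adj hvw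
          by_cases hv : v ∈ c.supp
          · have hw := hiff.1 hv
            rw [hpos x v hv, hpos x w hw]
            exact hx.2 ⟨v, hv⟩ ⟨w, hw⟩ hvw
          · have hw := fun h => hv (hiff.2 h)
            rw [hneg x v hv, hneg x w hw]
            exact hmem.2 v w hvw
      have e₁ : σ (fun v => a v) = d := by
        funext v
        by_cases hv : v ∈ c.supp
        · have : K.connectedComponentMk v ∉ s := by
            rw [SimpleGraph.ConnectedComponent.mem_supp_iff] at hv
            rwa [hv]
          refine (hpos (fun v : c.supp => a v) v hv).trans ?_
          simp [hd, this]
        · refine (hneg (fun v : c.supp => a v) v hv).trans ?_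
          rfl
      have e₂ : σ (fun v => b v) =
          fun v => if K.connectedComponentMk v ∈ insert c s then b v else a v := by
        funext v
        by_cases hv : v ∈ c.supp
        · exact (hpos (fun v : c.supp => b v) v hv).trans
            (if_pos (Finset.mem_insert.2 (Or.inl hv))).symm
        · refine (hneg (fun v : c.supp => b v) v hv).trans ?_
          have hv' : K.connectedComponentMk v ≠ c := hv
          simp [hd, hv']
      have hstep := Deform.map (σ := σ) (Y := SignedConfig K Λ) ?_ hσ ?_
        (h c Λ' _ (hres a ha) _ (hres b hb))
      · rw [e₁, e₂] at hstep
        exact ⟨e₂ ▸ hσ (hres b hb), e.trans hstep⟩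
      · refine continuous_pi fun v => ?_
        by_cases hv : v ∈ c.supp
        · simpa only [hpos _ v hv] using continuous_apply (⟨v, hv⟩ : c.supp)
        · simpa only [hneg _ v hv] using continuous_const
      · intro x y hxy v
        by_cases hv : v ∈ c.supp
        · rw [hpos _ v hv, hpos _ v hv]
          exact hxy _
        · rw [hneg _ v hv, hneg _ v hv]
          exact SameLine.refl _
  simpa using (key Finset.univ).2

/-- `γ 0, γ 1, …, γ n = γ 0` runs once around the cycle graph `K`. -/
structure IsCycleEnum {V : Type*} (K : SimpleGraph V) (n : ℕ) (γ : ℕ → V) : Prop where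
  closed : γ n = γ 0
  inj : ∀ i < n, ∀ j < n, γ i = γ j → i = j
  surj : ∀ v, ∃ i < n, γ i = v
  adj : ∀ i < n, K.Adj (γ i) (γ (i + 1))
  eq_of_adj : ∀ v w, K.Adj v w →
    ∃ i < n, (v = γ i ∧ w = γ (i + 1)) ∨ (w = γ i ∧ v = γ (i + 1))

theorem exists_isCycleEnum {V : Type*} {K : SimpleGraph V} {n : ℕ} (hn : 3 ≤ n)
    (e : K ≃g SimpleGraph.cycleGraph n) (z : V) : ∃ γ, IsCycleEnum K n γ ∧ γ 0 = z := by
  obtain ⟨k, rfl⟩ := Nat.exists_eq_add_of_le' hn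
  have hadj : ∀ u v : ZMod (k + 3),
      (SimpleGraph.cycleGraph (k + 3)).Adj u v ↔ u - v = 1 ∨ v - u = 1 := fun u v =>
    SimpleGraph.cycleGraph_adj
  let f : V ≃ ZMod (k + 3) := e.toEquiv
  have hf : ∀ u v, K.Adj u v ↔ f u - f v = 1 ∨ f v - f u = 1 := fun u v =>
    (e.map_adj_iff (v := u) (w := v)).symm.trans (hadj (f u) (f v))
  have hinj : ∀ i < k + 3, ∀ j < k + 3, (i : ZMod (k + 3)) = j → i = j := by
    intro i hi j hj h
    rwa [ZMod.natCast_eq_natCast_iff', Nat.mod_eq_of_lt hi, Nat.mod_eq_of_lt hj] at h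
  have hsurj : ∀ v, ∃ i < k + 3, f.symm (f z + (i : ℕ)) = v := by
    intro v
    refine ⟨(f v - f z).val, ZMod.val_lt _, ?_⟩
    rw [ZMod.natCast_zmod_val, add_sub_cancel, Equiv.symm_apply_apply]
  refine ⟨fun j => f.symm (f z + (j : ℕ)), ⟨?_, ?_, hsurj, ?_, ?_⟩, by simp⟩
  · simp only [ZMod.natCast_self, Nat.cast_zero]
  · intro i hi j hj h
    exact hinj i hi j hj (add_left_cancel (f.symm.injective h))
  · intro i _
    rw [hf]
    right
    simp only [Equiv.apply_symm_apply]
    push_cast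
    ring
  · intro v w hvw
    rcases (hf v w).1 hvw with h | h
    · obtain ⟨i, hi, rfl⟩ := hsurj w
      refine ⟨i, hi, Or.inr ⟨rfl, f.injective ?_⟩⟩
      rw [Equiv.apply_symm_apply] at h ⊢
      rw [sub_eq_iff_eq_add.1 h]
      push_cast
      ring
    · obtain ⟨i, hi, rfl⟩ := hsurj v
      refine ⟨i, hi, Or.inl ⟨rfl, f.injective ?_⟩⟩
      rw [Equiv.apply_symm_apply] at h ⊢
      rw [sub_eq_iff_eq_add.1 h]
      push_cast
      ring

namespace IsCycleEnum

variable {V : Type*} {K : SimpleGraph V} {Λ : Sym2 V → ℤˣ} {a b : V → Quaternion ℝ} {n : ℕ}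
  {γ : ℕ → V}

theorem deform_of_mem_centralVertices (h : IsCycleEnum K n γ) (hn : 0 < n)
    (h0 : γ 0 ∈ centralVertices K Λ) (ha : a ∈ NormalConfig K Λ) (hb : b ∈ NormalConfig K Λ) :
    Deform (SignedConfig K Λ) a b := by
  have key : ∀ k, k < n → ∃ a' ∈ NormalConfig K Λ, Deform (SignedConfig K Λ) a a' ∧
      ∀ i ≤ k, SameLine (a' (γ i)) (b (γ i)) := by
    intro k
    induction k with
    | zero =>
      refine fun _ => ⟨a, ha, Deform.refl a, fun i hi => ?_⟩
      rw [Nat.le_zero.1 hi, ha.2.1 _ h0, hb.2.1 _ h0]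
      exact SameLine.refl 1
    | succ k ih =>
      intro hk
      obtain ⟨a', ha', e, hl⟩ := ih (by omega)
      obtain ⟨a'', ha'', e', hout, hw⟩ := NormalConfig.exists_deform_branch ha' hb
        (h.adj k (by omega)) (hl k le_rfl) {x | ∃ j, k + 1 ≤ j ∧ j < n ∧ γ j = x}
        ⟨k + 1, le_rfl, hk, rfl⟩ (by
          rintro x y hxy hx ⟨j, hkj, hj, rfl⟩
          obtain ⟨i, hi, ⟨rfl, hy⟩ | ⟨hy, rfl⟩⟩ := h.eq_of_adj _ _ hxy
          · left
            rcases (Nat.succ_le_of_lt hi).lt_or_eq with hi' | hi'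
            · have := h.inj _ hj _ hi' hy
              by_cases hik : i = k
              · rw [hik]
              · exact absurd ⟨i, by omega, hi, rfl⟩ hx
            · rw [show i + 1 = n from hi', h.closed] at hy
              have := h.inj _ hj _ hn hy
              omega
          · right
            have := h.inj _ hj _ hi hy
            rcases (Nat.succ_le_of_lt hi).lt_or_eq with hi' | hi'
            · exact absurd ⟨i + 1, by omega, hi', rfl⟩ hx
            · rw [show i + 1 = n from hi', h.closed]
              exact ha'.2.1 _ h0)
      refine ⟨a'', ha'', e.trans e', fun i hi => ?_⟩
      rcases hi.lt_or_eq with hi | rfl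
      · rw [hout]
        · exact hl i (by omega)
        · rintro ⟨j, hkj, hj, hji⟩
          have := h.inj _ hj i (by omega) hji
          omega
      · exact hw
  obtain ⟨a', ha', e, hl⟩ := key (n - 1) (by omega)
  refine e.trans (Deform.of_sameLine ha'.1 hb.1 fun v => ?_)
  obtain ⟨i, hi, rfl⟩ := h.surj v
  exact hl i (by omega)

end IsCycleEnum

/-- The number of edges with sign `-1` among the first `j` edges of `γ`. -/
def signCount {V : Type*} (Λ : Sym2 V → ℤˣ) (γ : ℕ → V) : ℕ → ℕ
  | 0 => 0
  | j + 1 => signCount Λ γ j + if Λ s(γ j, γ (j + 1)) = 1 then 0 else 1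

theorem signCount_mono {V : Type*} (Λ : Sym2 V → ℤˣ) (γ : ℕ → V) : Monotone (signCount Λ γ) :=
  monotone_nat_of_le_succ fun _ => Nat.le_add_right _ _

namespace IsCycleEnum

variable {V : Type*} {K : SimpleGraph V} {Λ : Sym2 V → ℤˣ} {a b : V → Quaternion ℝ} {n : ℕ}
  {γ : ℕ → V}

theorem exists_orthoChain (h : IsCycleEnum K n γ) (ha : a ∈ SignedConfig K Λ)
    (haI : ∀ v, IsImaginary (a v)) : ∀ k ≤ n,
      ∃ w ∈ OrthoChain (signCount Λ γ k) (a (γ 0)) (a (γ k)),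
      ∀ j ≤ k, SameLine (a (γ j)) (w (signCount Λ γ j)) := by
  intro k
  induction k with
  | zero =>
    refine fun _ => ⟨fun i => if i = 0 then a (γ 0) else 1, ⟨fun i hi => ?_, fun i hi => ?_,
      fun i hi => ?_, ?_, ?_⟩, fun j hj => ?_⟩
    · have : i = 0 := by simpa [signCount] using hi
      simpa [this] using haI _
    · have : i ≠ 0 := by simpa [signCount, Nat.pos_iff_ne_zero] using hi
      simp [this]
    · simp [signCount] at hi
    · simp [signCommute_one]
    · simp [signCommute_one, signCount]
    · simpa [Nat.le_zero.1 hj, signCount] using SameLine.refl (a (γ 0))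
  | succ k ih =>
    intro hk
    obtain ⟨w, ⟨hI, hone, hadj, hp, hq⟩, hl⟩ := ih (by omega)
    have hedge := ha.2 _ _ (h.adj k (by omega))
    by_cases hε : Λ s(γ k, γ (k + 1)) = 1
    · have hk1 : signCount Λ γ (k + 1) = signCount Λ γ k := by simp [signCount, hε]
      rw [hε] at hedge
      have hs := (haI (γ k)).sameLine_of_commute (haI _) (signCommute_one.1 hedge)
      refine ⟨w, ?_, fun j hj => ?_⟩
      · rw [hk1]
        exact ⟨hI, hone, hadj, hp, hq.sameLine_right hs⟩
      · rcases hj.lt_or_eq with hj | rfl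
        · exact hl j (by omega)
        · rw [hk1]
          exact hs.symm.trans (hl k le_rfl)
    · have hk1 : signCount Λ γ (k + 1) = signCount Λ γ k + 1 := by simp [signCount, hε]
      rw [(Int.units_eq_one_or _).resolve_left hε] at hedge
      set m := signCount Λ γ k with hm
      refine ⟨Function.update w (m + 1) (a (γ (k + 1))), ?_, fun j hj => ?_⟩
      · rw [hk1]
        refine ⟨fun i hi => ?_, fun i hi => ?_, fun i hi => ?_, ?_, ?_⟩
        · by_cases h' : i = m + 1
          · simpa [h'] using haI _
          · simpa [h'] using hI i (by omega)
        · rw [Function.update_of_ne (by omega)]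
          exact hone i (by omega)
        · rw [Function.update_of_ne (by omega)]
          by_cases h' : i = m
          · simpa [h'] using hedge.sameLine_left (hl k le_rfl)
          · rw [Function.update_of_ne (by omega)]
            exact hadj i (by omega)
        · rw [Function.update_of_ne (by omega)]
          exact hp
        · simp [signCommute_one]
      · rcases hj.lt_or_eq with hj | rfl
        · have := signCount_mono Λ γ (Nat.le_of_lt_succ hj)
          rw [Function.update_of_ne (by omega)]
          exact hl j (by omega)
        · rw [hk1]
          simpa using SameLine.refl _

theorem deform_of_isImaginary (h : IsCycleEnum K n γ) (hn : 0 < n) (ha : a ∈ SignedConfig K Λ)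
    (hb : b ∈ SignedConfig K Λ) (haI : ∀ v, IsImaginary (a v)) (hbI : ∀ v, IsImaginary (b v))
    (hl : SameLine (a (γ 0)) (b (γ 0))) : Deform (SignedConfig K Λ) a b := by
  choose idx hidx hγ using h.surj
  have hidx' : ∀ i < n, idx (γ i) = i := fun i hi => h.inj _ (hidx _) _ hi (hγ _)
  set β := signCount Λ γ with hβ
  set p := b (γ 0) with hp
  let σ : (ℕ → Quaternion ℝ) → V → Quaternion ℝ := fun w v => w (β (idx v))
  have hσ : Set.MapsTo σ (OrthoChain (β n) p p) (SignedConfig K Λ) := by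
    rintro w ⟨hI, hone, hadj, h0, hm⟩
    have hl0 := (hI 0 (by omega)).sameLine_of_commute (hbI _) (signCommute_one.1 h0)
    have hlm := (hI _ le_rfl).sameLine_of_commute (hbI _) (signCommute_one.1 hm)
    have hnext : ∀ i < n, SameLine (w (β (i + 1))) (σ w (γ (i + 1))) := by
      intro i hi
      rcases (Nat.succ_le_of_lt hi).lt_or_eq with hi' | hi'
      · simp only [σ, hidx' _ hi']
        exact SameLine.refl _
      · rw [show i + 1 = n from hi', h.closed]
        simp only [σ, hidx' _ hn]
        exact hlm.trans hl0.symm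
    have hedge : ∀ i < n,
        SignCommute (Λ s(γ i, γ (i + 1))) (σ w (γ i)) (σ w (γ (i + 1))) := by
      intro i hi
      refine SignCommute.sameLine_right ?_ (hnext i hi)
      simp only [σ, hidx' _ hi]
      by_cases hε : Λ s(γ i, γ (i + 1)) = 1
      · have hi1 : β (i + 1) = β i := by simp [hβ, signCount, hε]
        rw [hi1, hε, signCommute_one]
      · have hi1 : β (i + 1) = β i + 1 := by simp [hβ, signCount, hε]
        have := signCount_mono Λ γ (Nat.succ_le_of_lt hi)
        rw [hi1, (Int.units_eq_one_or _).resolve_left hε]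
        exact hadj _ (by rw [Nat.succ_eq_add_one, ← hβ, hi1] at this; omega)
    refine ⟨fun v => (hI _ (signCount_mono Λ γ (hidx v).le)).2, fun v w hvw => ?_⟩
    obtain ⟨i, hi, ⟨rfl, rfl⟩ | ⟨rfl, rfl⟩⟩ := h.eq_of_adj _ _ hvw
    · exact hedge i hi
    · rw [Sym2.eq_swap]
      exact (hedge i hi).symm
  have key : ∀ c ∈ SignedConfig K Λ, (∀ v, IsImaginary (c v)) → SameLine (c (γ 0)) p →
      ∃ w ∈ OrthoChain (β n) p p, Deform (SignedConfig K Λ) c (σ w) := by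
    intro c hc hcI hcp
    obtain ⟨w, hw, hcw⟩ := h.exists_orthoChain hc hcI n le_rfl
    rw [h.closed] at hw
    obtain ⟨hI, hone, hadj, h0, hm⟩ := hw
    have hw : w ∈ OrthoChain (β n) p p :=
      ⟨hI, hone, hadj, h0.sameLine_right hcp, hm.sameLine_right hcp⟩
    refine ⟨w, hw, Deform.of_sameLine hc (hσ hw) fun v => ?_⟩
    have := hcw (idx v) (hidx v).le
    rwa [hγ] at this
  obtain ⟨w, hw, e⟩ := key a ha haI hl
  obtain ⟨w', hw', e'⟩ := key b hb hbI (SameLine.refl p)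
  refine (e.trans (Deform.map ?_ hσ (fun x y hxy v => hxy _)
    (OrthoChain.deform (hbI _) (hbI _) hw hw'))).trans e'.symm
  exact continuous_pi fun v => continuous_apply _

end IsCycleEnum

theorem signConnected_of_cycleGraph_iso {V : Type*} {K : SimpleGraph V} {n : ℕ} (hn : 3 ≤ n)
    (e : K ≃g SimpleGraph.cycleGraph n) : SignConnected K := by
  refine signConnected_of_normalConfig fun Λ a ha b hb => ?_
  by_cases hZ : ∃ z, z ∈ centralVertices K Λ
  · obtain ⟨z, hz⟩ := hZ
    obtain ⟨γ, hγ, rfl⟩ := exists_isCycleEnum hn e z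
    exact hγ.deform_of_mem_centralVertices (by omega) hz ha hb
  · push Not at hZ
    obtain ⟨γ, hγ, -⟩ := exists_isCycleEnum hn e (e.symm ⟨0, by omega⟩)
    obtain ⟨a', ha', d, hl⟩ := NormalConfig.exists_deform_sameLine ha hb (γ 0)
    exact d.trans (hγ.deform_of_isImaginary (by omega) ha'.1 hb.1 (fun v => ha'.2.2 v (hZ v))
      (fun v => hb.2.2 v (hZ v)) hl)

theorem signConnected_of_components_tree_or_cycle_or_complete {V : Type*} [Finite V]
    {K : SimpleGraph V}
    (hK : ∀ c : K.ConnectedComponent,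
      (K.induce c.supp).IsTree ∨
      (∃ n : ℕ, 3 ≤ n ∧ Nonempty (K.induce c.supp ≃g SimpleGraph.cycleGraph n)) ∨
      K.induce c.supp = ⊤) : SignConnected K := by
  refine signConnected_of_components fun c => ?_
  rcases hK c with h | ⟨n, hn, ⟨e⟩⟩ | h
  · exact signConnected_of_isTree h
  · exact signConnected_of_cycleGraph_iso hn e
  · rw [h]
    exact signConnected_top

section

open scoped Quaternion

@[simp] theorem imQuat_re (v : Fin 3 → ℝ) : (imQuat v).re = 0 := rfl
@[simp] theorem imQuat_imI (v : Fin 3 → ℝ) : (imQuat v).imI = v 0 := rfl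
@[simp] theorem imQuat_imJ (v : Fin 3 → ℝ) : (imQuat v).imJ = v 1 := rfl
@[simp] theorem imQuat_imK (v : Fin 3 → ℝ) : (imQuat v).imK = v 2 := rfl

theorem imQuat_injective : Function.Injective imQuat := by
  intro v w h
  funext i
  fin_cases i
  · exact congrArg QuaternionAlgebra.imI h
  · exact congrArg QuaternionAlgebra.imJ h
  · exact congrArg QuaternionAlgebra.imK h

namespace QuatLift

variable {p q : Quaternion ℝ} {x y : Matrix (Fin 3) (Fin 3) ℝ}

theorem unique (hx : QuatLift q x) (hy : QuatLift q y) : x = y := by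
  refine Matrix.mulVec_injective (funext fun v => imQuat_injective ?_)
  exact (hx v).symm.trans (hy v)

theorem mul (hp : QuatLift p x) (hq : QuatLift q y) : QuatLift (p * q) (x * y) := by
  intro v
  rw [← Matrix.mulVec_mulVec, ← hp, ← hq, mul_inv_rev]
  simp only [mul_assoc]

theorem smul (hq : QuatLift q x) {s : ℝ} (hs : s ≠ 0) : QuatLift (s • q) x := by
  intro v
  rw [← hq v, smul_inv₀, smul_mul_assoc, smul_mul_assoc, mul_smul_comm, smul_smul,
    mul_inv_cancel₀ hs, one_smul]

theorem sameLine (hp : QuatLift p x) (hq : QuatLift q x) (hp0 : p ≠ 0) (hq0 : q ≠ 0) :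
    SameLine p q := by
  have hcomm : ∀ v, p⁻¹ * q * imQuat v = imQuat v * (p⁻¹ * q) := by
    intro v
    have h := (hp v).trans (hq v).symm
    have h1 : p * imQuat v * p⁻¹ * q = q * imQuat v := by
      rw [h, inv_mul_cancel_right₀ hq0]
    rw [mul_assoc, ← h1]
    simp only [mul_assoc, inv_mul_cancel_left₀ hp0]
  have hI : ∀ v : Fin 3 → ℝ, v ≠ 0 → IsImaginary (imQuat v) := fun v hv =>
    ⟨rfl, fun h => hv (imQuat_injective (h.trans (by apply Quaternion.ext <;> simp)))⟩
  have key := eq_coe_re_of_commute (hI ![1, 0, 0] (by simp)) (hI ![0, 1, 0] (by simp))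
    (by rw [signCommute_neg_one]; apply Quaternion.ext <;> simp) (hcomm _) (hcomm _)
  have h0 : p⁻¹ * q ≠ 0 := mul_ne_zero (inv_ne_zero hp0) hq0
  refine ⟨(p⁻¹ * q).re, fun h => h0 (by rw [key, h, Quaternion.coe_zero]), ?_⟩
  rw [← Quaternion.mul_coe_eq_smul, ← key, mul_inv_cancel_left₀ hp0]

end QuatLift

/-- The rotation matrix of the conjugation by a nonzero quaternion. -/
def rotMat (q : Quaternion ℝ) : Matrix (Fin 3) (Fin 3) ℝ :=
  (Quaternion.normSq q)⁻¹ •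
    !![q.re ^ 2 + q.imI ^ 2 - q.imJ ^ 2 - q.imK ^ 2, 2 * (q.imI * q.imJ - q.re * q.imK),
        2 * (q.imI * q.imK + q.re * q.imJ);
      2 * (q.imI * q.imJ + q.re * q.imK), q.re ^ 2 - q.imI ^ 2 + q.imJ ^ 2 - q.imK ^ 2,
        2 * (q.imJ * q.imK - q.re * q.imI);
      2 * (q.imI * q.imK - q.re * q.imJ), 2 * (q.imJ * q.imK + q.re * q.imI),
        q.re ^ 2 - q.imI ^ 2 - q.imJ ^ 2 + q.imK ^ 2]

theorem quatLift_rotMat {q : Quaternion ℝ} (hq : q ≠ 0) : QuatLift q (rotMat q) := by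
  intro v
  have hN : Quaternion.normSq q ≠ 0 := Quaternion.normSq_ne_zero.2 hq
  rw [mul_inv_eq_iff_eq_mul₀ hq]
  have h : Quaternion.normSq q • (q * imQuat v) =
      Quaternion.normSq q • (imQuat ((rotMat q).mulVec v) * q) := by
    rw [← smul_mul_assoc (Quaternion.normSq q) (imQuat _)]
    have : Quaternion.normSq q • imQuat ((rotMat q).mulVec v) =
        imQuat ((Quaternion.normSq q • rotMat q).mulVec v) := by
      rw [Matrix.smul_mulVec]
      apply Quaternion.ext <;> simp
    rw [this, rotMat, smul_inv_smul₀ hN, Quaternion.normSq_def']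
    apply Quaternion.ext <;>
      simp [dotProduct, Fin.sum_univ_three] <;> ring
  exact smul_right_injective _ hN h

theorem rotMat_mem {q : Quaternion ℝ} (hq : q ≠ 0) :
    rotMat q * (rotMat q).transpose = 1 ∧ (rotMat q).det = 1 := by
  have hN : Quaternion.normSq q ≠ 0 := Quaternion.normSq_ne_zero.2 hq
  have hdef := Quaternion.normSq_def' q
  constructor
  · rw [rotMat, Matrix.transpose_smul, Matrix.smul_mul, Matrix.mul_smul, smul_smul,
      ← mul_inv, inv_smul_eq_iff₀ (mul_ne_zero hN hN), hdef]
    ext i j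
    fin_cases i <;> fin_cases j <;>
      simp [Matrix.mul_apply, Fin.sum_univ_three] <;> ring
  · rw [rotMat, Matrix.det_smul, Matrix.det_fin_three, Fintype.card_fin, inv_pow,
      inv_mul_eq_iff_eq_mul₀ (pow_ne_zero 3 hN), hdef]
    simp
    ring

theorem continuousOn_rotMat : ContinuousOn rotMat {q | q ≠ 0} := by
  have hN : ContinuousOn (fun q : Quaternion ℝ => (Quaternion.normSq q)⁻¹) {q | q ≠ 0} :=
    Quaternion.continuous_normSq.continuousOn.inv₀ fun q hq => Quaternion.normSq_ne_zero.2 hq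
  refine hN.smul (Continuous.continuousOn ?_)
  have hr := Quaternion.continuous_re
  have hI := Quaternion.continuous_imI
  have hJ := Quaternion.continuous_imJ
  have hK := Quaternion.continuous_imK
  refine continuous_matrix fun i j => ?_
  fin_cases i <;> fin_cases j <;> simp <;> fun_prop

theorem exists_quatLift {A : Matrix (Fin 3) (Fin 3) ℝ} (hA : A * A.transpose = 1)
    (hdet : A.det = 1) : ∃ q, q ≠ 0 ∧ QuatLift q A := by
  have hadj : A.adjugate = A.transpose := by
    have h := congrArg (A.adjugate * ·) hA
    simpa [← mul_assoc, Matrix.adjugate_mul, hdet] using h.symm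
  have hA' : A.transpose * A = 1 := mul_eq_one_comm.1 hA
  have h00 := congrFun₂ hA' 0 0
  have h11 := congrFun₂ hA' 1 1
  have h01 := congrFun₂ hA' 0 1
  have h20 := congrFun₂ hadj 2 0
  have h21 := congrFun₂ hadj 2 1
  have h22 := congrFun₂ hadj 2 2
  rw [Matrix.adjugate_fin_three] at h20 h21 h22
  simp [Matrix.mul_apply, Fin.sum_univ_three] at h00 h11 h01 h20 h21 h22
  set i : Quaternion ℝ := imQuat ![1, 0, 0] with hi
  set j : Quaternion ℝ := imQuat ![0, 1, 0] with hj
  set k : Quaternion ℝ := imQuat ![0, 0, 1] with hk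
  set U : Quaternion ℝ := imQuat ![A 0 0, A 1 0, A 2 0] with hU
  set V : Quaternion ℝ := imQuat ![A 0 1, A 1 1, A 2 1] with hV
  set W : Quaternion ℝ := imQuat ![A 0 2, A 1 2, A 2 2] with hW
  have hUU : U * U = -1 := by
    apply Quaternion.ext <;> simp [hU] <;> linarith
  have hVV : V * V = -1 := by
    apply Quaternion.ext <;> simp [hV] <;> linarith
  have hUV : U * V = W := by
    apply Quaternion.ext <;> simp [hU, hV, hW] <;> linarith
  have hVU : V * U = -W := by
    apply Quaternion.ext <;> simp [hU, hV, hW] <;> linarith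
  have hii : i * i = -1 := by apply Quaternion.ext <;> simp [hi]
  have hjj : j * j = -1 := by apply Quaternion.ext <;> simp [hj]
  have hkk : k * k = -1 := by apply Quaternion.ext <;> simp [hk]
  have hij : i * j = k := by apply Quaternion.ext <;> simp [hi, hj, hk]
  have hji : j * i = -k := by apply Quaternion.ext <;> simp [hi, hj, hk]
  have hjk : j * k = i := by apply Quaternion.ext <;> simp [hi, hj, hk]
  have hkj : k * j = -i := by apply Quaternion.ext <;> simp [hi, hj, hk]
  have hki : k * i = j := by apply Quaternion.ext <;> simp [hi, hj, hk]
  have hik : i * k = -j := by apply Quaternion.ext <;> simp [hi, hj, hk]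
  have hUW : U * W = -V := by rw [← hUV, ← mul_assoc, hUU, neg_one_mul]
  have hVW : V * W = U := by
    rw [← neg_neg (V * W), ← mul_neg, ← hVU, ← mul_assoc, hVV, neg_one_mul, neg_neg]
  -- average over the quaternion group
  let Q : Quaternion ℝ → Quaternion ℝ := fun x => x - U * x * i - V * x * j - W * x * k
  have hQi : ∀ x, Q x * i = U * Q x := by
    intro x
    simp only [Q, sub_mul, mul_sub, ← mul_assoc, hUU, hUV, hUW]
    simp only [mul_assoc, hii, hji, hki]
    simp only [mul_neg, neg_mul, mul_one, one_mul]
    abel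
  have hQj : ∀ x, Q x * j = V * Q x := by
    intro x
    simp only [Q, sub_mul, mul_sub, ← mul_assoc, hVU, hVV, hVW]
    simp only [mul_assoc, hij, hjj, hkj]
    simp only [mul_neg, neg_mul, mul_one, one_mul]
    abel
  have hQk : ∀ x, Q x * k = W * Q x := by
    intro x
    rw [← hij, ← mul_assoc, hQi, mul_assoc, hQj, ← mul_assoc, hUV]
  have hne : ∃ x, Q x ≠ 0 := by
    by_contra! h
    have h4 : Q 1 - Q i * i - Q j * j - Q k * k = 1 + 1 + 1 + 1 := by
      simp only [Q, sub_mul, mul_assoc, hii, hjj, hkk, hij, hji, hjk, hkj, hki, hik,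
        one_mul, mul_one, mul_neg, neg_mul, neg_neg]
      abel
    simp only [h, zero_mul, sub_zero] at h4
    have h5 := congrArg QuaternionAlgebra.re h4
    simp only [Quaternion.re_add, Quaternion.re_zero, Quaternion.re_one] at h5
    norm_num at h5
  obtain ⟨x, hx⟩ := hne
  refine ⟨Q x, hx, fun v => ?_⟩
  rw [mul_inv_eq_iff_eq_mul₀ hx]
  have h1 : imQuat v = v 0 • i + v 1 • j + v 2 • k := by
    apply Quaternion.ext <;> simp [hi, hj, hk]
  have h2 : imQuat (A.mulVec v) = v 0 • U + v 1 • V + v 2 • W := by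
    apply Quaternion.ext <;>
      simp [hU, hV, hW, Matrix.mulVec, dotProduct, Fin.sum_univ_three, mul_comm]
  rw [h1, h2]
  simp only [mul_add, add_mul, mul_smul_comm, smul_mul_assoc, hQi, hQj, hQk]

end

theorem QuatLift.of_sameLine {p q : Quaternion ℝ} {x : Matrix (Fin 3) (Fin 3) ℝ}
    (hp : QuatLift p x) (h : SameLine p q) : QuatLift q x := by
  obtain ⟨s, hs, rfl⟩ := h
  exact hp.smul hs

theorem rotMat_commute_of_signCommute {ε : ℤˣ} {p q : Quaternion ℝ} (hp : p ≠ 0) (hq : q ≠ 0)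
    (h : SignCommute ε p q) : rotMat p * rotMat q = rotMat q * rotMat p := by
  have h1 := (quatLift_rotMat hp).mul (quatLift_rotMat hq)
  rw [h] at h1
  refine h1.unique (((quatLift_rotMat hq).mul (quatLift_rotMat hp)).smul ?_)
  simp

section

variable {V : Type*} {K : SimpleGraph V} {Λ : Sym2 V → ℤˣ} {a b : V → Quaternion ℝ}

/-- The point of the representation variety with lifts `a`. -/
def SignedConfig.toRepVar (a : V → Quaternion ℝ) (ha : a ∈ SignedConfig K Λ) : RepVar K :=
  ⟨fun v => ⟨rotMat (a v), rotMat_mem (ha.1 v)⟩, fun v w h =>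
    rotMat_commute_of_signCommute (ha.1 v) (ha.1 w) (ha.2 v w h)⟩

theorem SignedConfig.toRepVar_eq (ha : a ∈ SignedConfig K Λ) {x : RepVar K}
    (h : ∀ v, QuatLift (a v) (x.1 v).1) : toRepVar a ha = x :=
  Subtype.ext (funext fun v => Subtype.ext ((quatLift_rotMat (ha.1 v)).unique (h v)))

theorem Deform.connectedComponent_eq (h : Deform (SignedConfig K Λ) a b) :
    (a ∈ SignedConfig K Λ ↔ b ∈ SignedConfig K Λ) ∧
      ∀ (ha : a ∈ SignedConfig K Λ) (hb : b ∈ SignedConfig K Λ),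
        connectedComponent (SignedConfig.toRepVar a ha) =
          connectedComponent (SignedConfig.toRepVar b hb) := by
  induction h with
  | rel a b h =>
    rcases h with ⟨f, hf, hX, rfl, rfl⟩ | ⟨ha, hb, hab⟩
    · refine ⟨iff_of_true (hX 0) (hX 1), fun _ _ => ?_⟩
      have hcont : Continuous fun t => SignedConfig.toRepVar (f t) (hX t) := by
        refine Continuous.subtype_mk (continuous_pi fun v => Continuous.subtype_mk ?_ _) _
        exact continuousOn_rotMat.comp_continuous ((continuous_apply v).comp hf)
          fun t => (hX t).1 v
      exact _root_.connectedComponent_eq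
        ((isPreconnected_range hcont).subset_connectedComponent ⟨0, rfl⟩ ⟨1, rfl⟩)
    · refine ⟨iff_of_true ha hb, fun _ _ => ?_⟩
      congr 1
      exact SignedConfig.toRepVar_eq _ fun v =>
        (quatLift_rotMat (hb.1 v)).of_sameLine (hab v).symm
  | refl a => exact ⟨Iff.rfl, fun _ _ => rfl⟩
  | symm a b _ ih => exact ⟨ih.1.symm, fun ha hb => (ih.2 hb ha).symm⟩
  | trans a b c _ _ ih ih' =>
    exact ⟨ih.1.trans ih'.1, fun ha hc => (ih.2 ha (ih.1.1 ha)).trans (ih'.2 _ hc)⟩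

theorem IsObstruction.exists_signedConfig {x : V → SO3} (h : IsObstruction K x Λ) :
    ∃ a ∈ SignedConfig K Λ, ∀ v, QuatLift (a v) (x v).1 := by
  choose a ha0 ha using fun v => exists_quatLift (x v).2.1 (x v).2.2
  refine ⟨a, ⟨ha0, fun v w hvw => ?_⟩, ha⟩
  obtain ⟨q, p, hq, hp, hqx, hpx, he⟩ := h v w hvw
  have hq0 : q ≠ 0 := norm_ne_zero_iff.1 (by rw [hq]; exact one_ne_zero)
  have hp0 : p ≠ 0 := norm_ne_zero_iff.1 (by rw [hp]; exact one_ne_zero)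
  have hqp : SignCommute (Λ s(v, w)) q p := by
    rw [mul_inv_eq_iff_eq_mul₀ hp0, mul_inv_eq_iff_eq_mul₀ hq0] at he
    rw [SignCommute, he]
    rcases Int.units_eq_one_or (Λ s(v, w)) with hε | hε <;> simp [hε]
  exact (hqp.sameLine_left (hqx.sameLine (ha v) hq0 (ha0 v))).sameLine_right
    (hpx.sameLine (ha w) hp0 (ha0 w))

theorem SignConnected.connectedComponent_eq (hK : SignConnected K) {x y : RepVar K}
    (hx : IsObstruction K x.1 Λ) (hy : IsObstruction K y.1 Λ) :
    connectedComponent x = connectedComponent y := by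
  obtain ⟨a, ha, hax⟩ := hx.exists_signedConfig
  obtain ⟨b, hb, hby⟩ := hy.exists_signedConfig
  have h := (hK Λ a ha b hb).connectedComponent_eq.2 ha hb
  rwa [SignedConfig.toRepVar_eq ha hax, SignedConfig.toRepVar_eq hb hby] at h

theorem exists_unit_quatLift (x : SO3) : ∃ q : Quaternion ℝ, ‖q‖ = 1 ∧ QuatLift q x.1 := by
  obtain ⟨q, hq, h⟩ := exists_quatLift x.2.1 x.2.2
  refine ⟨‖q‖⁻¹ • q, ?_, h.smul (inv_ne_zero (norm_ne_zero_iff.2 hq))⟩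
  rw [norm_smul, norm_inv, norm_norm, inv_mul_cancel₀ (norm_ne_zero_iff.2 hq)]

theorem exists_isObstruction (x : RepVar K) : ∃ Λ : Sym2 V → ℤˣ, IsObstruction K x.1 Λ := by
  classical
  choose a hn ha using fun v => exists_unit_quatLift (x.1 v)
  have ha0 : ∀ v, a v ≠ 0 := fun v => norm_ne_zero_iff.1 (by rw [hn]; exact one_ne_zero)
  refine ⟨fun e => if ∀ v w, e = s(v, w) → a v * a w = a w * a v then 1 else -1,
    fun v w hvw => ⟨a v, a w, hn v, hn w, ha v, ha w, ?_⟩⟩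
  have hiff : (∀ v' w', s(v, w) = s(v', w') → a v' * a w' = a w' * a v') ↔
      a v * a w = a w * a v := by
    refine ⟨fun h => h v w rfl, fun h v' w' he => ?_⟩
    rcases Sym2.eq_iff.1 he with ⟨rfl, rfl⟩ | ⟨rfl, rfl⟩
    · exact h
    · exact h.symm
  rw [mul_inv_eq_iff_eq_mul₀ (ha0 w), mul_inv_eq_iff_eq_mul₀ (ha0 v)]
  simp only [hiff]
  split_ifs with h
  · simpa using h
  · have h1 := (ha w).mul (ha v)
    rw [← x.2 v w hvw] at h1
    obtain ⟨s, hs, hs'⟩ := h1.sameLine ((ha v).mul (ha w)) (mul_ne_zero (ha0 w) (ha0 v))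
      (mul_ne_zero (ha0 v) (ha0 w))
    have habs : |s| = 1 := by
      have := congrArg norm hs'
      simpa [norm_smul, hn] using this.symm
    rcases eq_or_eq_neg_of_abs_eq habs with rfl | rfl
    · exact absurd (by simpa using hs') h
    · simpa using hs'

theorem IsObstruction.congr {x : V → SO3} {Λ' : Sym2 V → ℤˣ} (h : IsObstruction K x Λ)
    (hΛ : ∀ e ∈ K.edgeSet, Λ e = Λ' e) : IsObstruction K x Λ' := by
  intro v w hvw
  rw [← hΛ s(v, w) hvw]
  exact h v w hvw

theorem SignConnected.card_connectedComponents_le [Finite V] (hK : SignConnected K) :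
    Nat.card (ConnectedComponents (RepVar K)) ≤ 2 ^ Nat.card K.edgeSet := by
  choose Λ hΛ using fun x : RepVar K => exists_isObstruction x
  let f : ConnectedComponents (RepVar K) → K.edgeSet → ℤˣ := fun c e => Λ c.out e
  have hf : Function.Injective f := by
    intro c c' h
    rw [← c.out_eq, ← c'.out_eq]
    refine ConnectedComponents.coe_eq_coe.2 (hK.connectedComponent_eq (hΛ _) ?_)
    exact (hΛ _).congr fun e he => (congrFun h ⟨e, he⟩).symm
  have hcard := Nat.card_le_card_of_injective f hf
  rwa [Nat.card_fun, Nat.card_eq_fintype_card (α := ℤˣ), Fintype.card_units_int] at hcard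

end

theorem obstruction_injective_on_components
    {V : Type} [Fintype V] (K : SimpleGraph V)
    (hK : ∀ c : K.ConnectedComponent,
      (K.induce c.supp).IsTree ∨
      (∃ n : ℕ, 3 ≤ n ∧ Nonempty (K.induce c.supp ≃g SimpleGraph.cycleGraph n)) ∨
      K.induce c.supp = ⊤) :
    (∀ x y : RepVar K, ∀ Λ : Sym2 V → ℤˣ,
        IsObstruction K x.1 Λ → IsObstruction K y.1 Λ →
        connectedComponent x = connectedComponent y) ∧
    Nat.card (ConnectedComponents (RepVar K)) ≤ 2 ^ Nat.card K.edgeSet := by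
  have h := signConnected_of_components_tree_or_cycle_or_complete hK
  exact ⟨fun _ _ _ hx hy => h.connectedComponent_eq hx hy, h.card_connectedComponents_le⟩

end
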